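/- Every pseudo uplifting cardinal κ is Σ₃-reflecting and is a limit of Σ₃-reflecting cardinals: for every Σ₃ formula φ(x) and every a ∈ V_κ, φ(a) holds in the universe of sets if and only if V_κ ⊨ φ(a), and for every ordinal θ < κ there is a Σ₃-reflecting cardinal β with θ < β < κ. -/

import Mathlib

open FirstOrder Language

universe u

namespace Paper

/-- The language of set theory: a single binary relation symbol (membership).
We reuse `FirstOrder.Language.graph`, whose sole symbol is a binary relation. -/
abbrev LSet : FirstOrder.Language := FirstOrder.Language.graph

/-- The rank-initial segment `V_α` of the cumulative hierarchy, realized as the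
collection of ZF sets of rank less than `α`. -/
abbrev Vt (α : Ordinal) : Type 1 := {x : ZFSet // x.rank < α}

/-- `V_α` as a structure in the language of set theory, with the membership relation. -/
instance VtStructure (α : Ordinal) : LSet.Structure (Vt α) where
  funMap := fun f _ => f.elim
  RelMap := fun r x => match r with | .adj => (x 0).1 ∈ (x 1).1

/-- The universe of sets as a structure in the language of set theory. -/
instance ZFSetStructure : LSet.Structure ZFSet where
  funMap := fun f _ => f.elim
  RelMap := fun r x => match r with | .adj => x 0 ∈ x 1

/-- `V_α ≺ V_β`: the inclusion of `V_α` into `V_β` is an elementary embedding. -/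
def VElem (α β : Ordinal) : Prop :=
  ∃ e : Vt α ↪ₑ[LSet] Vt β, ∀ x : Vt α, (e x : ZFSet) = x

/-- An ordinal which is a cardinal. -/
def IsCardOrd (γ : Ordinal) : Prop := γ.card.ord = γ

/-- An ordinal which is a regular cardinal. -/
def IsRegularOrd (γ : Ordinal) : Prop := γ.card.IsRegular ∧ γ.card.ord = γ

/-- An ordinal which is an inaccessible cardinal (uncountable, regular, strong limit). -/
def IsInaccOrd (γ : Ordinal) : Prop := γ.card.IsInaccessible ∧ γ.card.ord = γ

/-- An inaccessible cardinal `κ` is uplifting if for every ordinal `θ` there is an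
inaccessible cardinal `γ ≥ θ` such that `V_κ ≺ V_γ` is a proper elementary extension. -/
def IsUplifting (κ : Ordinal) : Prop :=
  IsInaccOrd κ ∧ ∀ θ : Ordinal, ∃ γ : Ordinal, IsInaccOrd γ ∧ θ ≤ γ ∧ κ < γ ∧ VElem κ γ

/-- An inaccessible cardinal `κ` is pseudo uplifting if for every ordinal `θ` there is a
cardinal `γ ≥ θ` such that `V_κ ≺ V_γ` is a proper elementary extension. -/
def IsPseudoUplifting (κ : Ordinal) : Prop :=
  IsInaccOrd κ ∧ ∀ θ : Ordinal, ∃ γ : Ordinal, IsCardOrd γ ∧ θ ≤ γ ∧ κ < γ ∧ VElem κ γ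

/-- The membership formula `t₁ ∈ t₂` between two terms. -/
def memBF {α : Type} {n : ℕ} (t₁ t₂ : LSet.Term (α ⊕ Fin n)) : LSet.BoundedFormula α n :=
  Language.adj.boundedFormula₂ t₁ t₂

/-- A formula of the language of set theory all of whose quantifiers are bounded
(of the form `∀ x ∈ t` or `∃ x ∈ t`): the Δ₀ formulas. -/
inductive IsDelta0 : ∀ {α : Type} {n : ℕ}, LSet.BoundedFormula α n → Prop
  | of_isQF {α n} {φ : LSet.BoundedFormula α n} : φ.IsQF → IsDelta0 φ
  | imp {α n} {φ ψ : LSet.BoundedFormula α n} :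
      IsDelta0 φ → IsDelta0 ψ → IsDelta0 (φ.imp ψ)
  | ball {α n} (t : LSet.Term (α ⊕ Fin n)) {φ : LSet.BoundedFormula α (n + 1)} :
      IsDelta0 φ →
      IsDelta0 ((memBF (Term.var (Sum.inr (Fin.last n)))
        (t.relabel (Sum.map id Fin.castSucc)) ⟹ φ).all)
  | bex {α n} (t : LSet.Term (α ⊕ Fin n)) {φ : LSet.BoundedFormula α (n + 1)} :
      IsDelta0 φ →
      IsDelta0 ((memBF (Term.var (Sum.inr (Fin.last n)))
        (t.relabel (Sum.map id Fin.castSucc)) ⊓ φ).ex)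

mutual
  /-- Σₖ formulas: `k` alternating blocks of quantifiers beginning with an existential
  block, followed by a Δ₀ formula (degenerate blocks allowed). -/
  inductive IsSigmaFml : ℕ → ∀ {α : Type} {n : ℕ}, LSet.BoundedFormula α n → Prop
    | of_delta0 {k : ℕ} {α n} {φ : LSet.BoundedFormula α n} : IsDelta0 φ → IsSigmaFml k φ
    | of_pi {k : ℕ} {α n} {φ : LSet.BoundedFormula α n} : IsPiFml k φ → IsSigmaFml (k + 1) φ
    | ex {k : ℕ} {α n} {φ : LSet.BoundedFormula α (n + 1)} :
        IsSigmaFml (k + 1) φ → IsSigmaFml (k + 1) φ.ex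
  /-- Πₖ formulas: `k` alternating blocks of quantifiers beginning with a universal
  block, followed by a Δ₀ formula (degenerate blocks allowed). -/
  inductive IsPiFml : ℕ → ∀ {α : Type} {n : ℕ}, LSet.BoundedFormula α n → Prop
    | of_delta0 {k : ℕ} {α n} {φ : LSet.BoundedFormula α n} : IsDelta0 φ → IsPiFml k φ
    | of_sigma {k : ℕ} {α n} {φ : LSet.BoundedFormula α n} : IsSigmaFml k φ → IsPiFml (k + 1) φ
    | all {k : ℕ} {α n} {φ : LSet.BoundedFormula α (n + 1)} :
        IsPiFml (k + 1) φ → IsPiFml (k + 1) φ.all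
end

/-- An inaccessible cardinal `κ` is Σₖ-reflecting if for every Σₖ formula `φ(x)` and every
`a ∈ V_κ`, `φ(a)` holds in the universe of sets if and only if `V_κ ⊨ φ(a)`. -/
def SigmaReflecting (k : ℕ) (κ : Ordinal) : Prop :=
  IsInaccOrd κ ∧ ∀ φ : LSet.Formula (Fin 1), IsSigmaFml k φ →
    ∀ (a : ZFSet) (ha : a.rank < κ),
      (φ.Realize (fun _ => a) ↔ φ.Realize (fun _ => (⟨a, ha⟩ : Vt κ)))

/-! ### Formulas with named variables -/

/-- Formulas of set theory with variables named by natural numbers. -/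
inductive Fm : Type
  | mem (i j : ℕ) : Fm
  | eq (i j : ℕ) : Fm
  | nand (φ ψ : Fm) : Fm
  | all (i : ℕ) (φ : Fm) : Fm

namespace Fm

/-- Negation. -/
def neg (φ : Fm) : Fm := nand φ φ
/-- Conjunction. -/
def and (φ ψ : Fm) : Fm := neg (nand φ ψ)
/-- Disjunction. -/
def or (φ ψ : Fm) : Fm := nand (neg φ) (neg ψ)
/-- Implication. -/
def imp (φ ψ : Fm) : Fm := nand φ (neg ψ)
/-- Equivalence. -/
def iff (φ ψ : Fm) : Fm := and (imp φ ψ) (imp ψ φ)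
/-- Existential quantification. -/
def ex (i : ℕ) (φ : Fm) : Fm := neg (all i (neg φ))
/-- Quantification `∀ xᵢ ∈ xⱼ`. -/
def ball (i j : ℕ) (φ : Fm) : Fm := all i (imp (mem i j) φ)
/-- Quantification `∃ xᵢ ∈ xⱼ`. -/
def bex (i j : ℕ) (φ : Fm) : Fm := ex i (and (mem i j) φ)

/-- Satisfaction in a type `M` whose elements name sets through `c`. -/
def Sat {M : Type 1} (c : M → ZFSet.{0}) : Fm → (ℕ → M) → Prop
  | mem i j, v => c (v i) ∈ c (v j)
  | eq i j, v => v i = v j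
  | nand φ ψ, v => ¬ (Sat c φ v ∧ Sat c ψ v)
  | all i φ, v => ∀ x, Sat c φ (Function.update v i x)

section Sat

variable {M : Type 1} {c : M → ZFSet.{0}} {v : ℕ → M} {φ ψ : Fm} {i j : ℕ}

@[simp] theorem sat_mem : Sat c (mem i j) v ↔ c (v i) ∈ c (v j) := Iff.rfl
@[simp] theorem sat_eq : Sat c (eq i j) v ↔ v i = v j := Iff.rfl
theorem sat_nand : Sat c (nand φ ψ) v ↔ ¬ (Sat c φ v ∧ Sat c ψ v) := Iff.rfl
@[simp] theorem sat_all : Sat c (all i φ) v ↔ ∀ x, Sat c φ (Function.update v i x) := Iff.rfl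
@[simp] theorem sat_neg : Sat c (neg φ) v ↔ ¬ Sat c φ v := by simp [neg, sat_nand]
@[simp] theorem sat_and : Sat c (and φ ψ) v ↔ Sat c φ v ∧ Sat c ψ v := by simp [and, sat_nand]
@[simp] theorem sat_or : Sat c (or φ ψ) v ↔ Sat c φ v ∨ Sat c ψ v := by
  simp only [or, sat_nand, sat_neg]; tauto
@[simp] theorem sat_imp : Sat c (imp φ ψ) v ↔ (Sat c φ v → Sat c ψ v) := by
  simp only [imp, sat_nand, sat_neg]; tauto
@[simp] theorem sat_iff : Sat c (iff φ ψ) v ↔ (Sat c φ v ↔ Sat c ψ v) := by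
  simp only [iff, sat_and, sat_imp]; tauto
@[simp] theorem sat_ex : Sat c (ex i φ) v ↔ ∃ x, Sat c φ (Function.update v i x) := by
  simp [ex]
@[simp] theorem sat_ball : Sat c (ball i j φ) v ↔
    ∀ x, c x ∈ c (Function.update v i x j) → Sat c φ (Function.update v i x) := by
  simp [ball]
@[simp] theorem sat_bex : Sat c (bex i j φ) v ↔
    ∃ x, c x ∈ c (Function.update v i x j) ∧ Sat c φ (Function.update v i x) := by
  simp [bex]

end Sat

/-- All variables of the formula, bound ones included, are smaller than `b`. -/
def varsLt (b : ℕ) : Fm → Bool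
  | mem i j => decide (i < b) && decide (j < b)
  | eq i j => decide (i < b) && decide (j < b)
  | nand φ ψ => varsLt b φ && varsLt b ψ
  | all i φ => decide (i < b) && varsLt b φ

/-- Relativization of all quantifiers to the variable `b`. -/
def rel (b : ℕ) : Fm → Fm
  | mem i j => mem i j
  | eq i j => eq i j
  | nand φ ψ => nand (rel b φ) (rel b ψ)
  | all i φ => ball i b (rel b φ)

theorem sat_congr {M : Type 1} {c : M → ZFSet.{0}} {b : ℕ} (φ : Fm) (hφ : varsLt b φ) :
    ∀ {v w : ℕ → M}, (∀ i < b, v i = w i) → (Sat c φ v ↔ Sat c φ w) := by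
  induction φ with
  | mem i j =>
    intro v w h
    simp only [varsLt, Bool.and_eq_true, decide_eq_true_eq] at hφ
    simp [h _ hφ.1, h _ hφ.2]
  | eq i j =>
    intro v w h
    simp only [varsLt, Bool.and_eq_true, decide_eq_true_eq] at hφ
    simp [h _ hφ.1, h _ hφ.2]
  | nand φ ψ ih1 ih2 =>
    intro v w h
    simp only [varsLt, Bool.and_eq_true] at hφ
    simp [sat_nand, ih1 hφ.1 h, ih2 hφ.2 h]
  | all k φ ih =>
    intro v w h
    simp only [varsLt, Bool.and_eq_true, decide_eq_true_eq] at hφ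
    refine forall_congr' fun x => ih hφ.2 fun i hi => ?_
    by_cases hik : i = k
    · subst hik; simp
    · simp [hik, h i hi]

theorem sat_rel {M M' : Type 1} {c : M → ZFSet.{0}} {c' : M' → ZFSet.{0}}
    (hc : Function.Injective c) (hc' : Function.Injective c') {b : ℕ} {B : M}
    (hB : ∀ z, z ∈ c B ↔ ∃ x', c' x' = z) (hr : ∀ x', ∃ x, c x = c' x')
    (φ : Fm) (hφ : varsLt b φ) :
    ∀ {v : ℕ → M} {v' : ℕ → M'}, v b = B → (∀ i < b, c (v i) = c' (v' i)) →
      (Sat c (rel b φ) v ↔ Sat c' φ v') := by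
  induction φ with
  | mem i j =>
    intro v w _ h
    simp only [varsLt, Bool.and_eq_true, decide_eq_true_eq] at hφ
    simp [rel, h _ hφ.1, h _ hφ.2]
  | eq i j =>
    intro v w _ h
    simp only [varsLt, Bool.and_eq_true, decide_eq_true_eq] at hφ
    simp [rel, ← hc.eq_iff, h _ hφ.1, h _ hφ.2, hc'.eq_iff]
  | nand φ ψ ih1 ih2 =>
    intro v w hb h
    simp only [varsLt, Bool.and_eq_true] at hφ
    simp [rel, sat_nand, ih1 hφ.1 hb h, ih2 hφ.2 hb h]
  | all k φ ih =>
    intro v w hb h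
    simp only [varsLt, Bool.and_eq_true, decide_eq_true_eq] at hφ
    have hkb : b ≠ k := hφ.1.ne'
    have key : ∀ x x', c x = c' x' →
        (Sat c (rel b φ) (Function.update v k x) ↔ Sat c' φ (Function.update w k x')) := by
      intro x x' hx
      refine ih hφ.2 (by simp [hkb, hb]) fun i hi => ?_
      by_cases hik : i = k
      · subst hik; simp [hx]
      · simp [hik, h i hi]
    simp only [rel, sat_ball, sat_all, Function.update_of_ne hkb, hb]
    constructor
    · intro H x'
      obtain ⟨x, hx⟩ := hr x'
      exact (key x x' hx).1 (H x ((hB _).2 ⟨x', hx.symm⟩))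
    · intro H x hx
      obtain ⟨x', hx'⟩ := (hB _).1 hx
      exact (key x x' hx'.symm).2 (H x')

theorem sat_embed {M M' : Type 1} {c : M → ZFSet.{0}} {c' : M' → ZFSet.{0}} (e : M → M')
    (he : Function.Bijective e) (hmem : ∀ x y, c' (e x) ∈ c' (e y) ↔ c x ∈ c y) (φ : Fm) :
    ∀ v : ℕ → M, Sat c' φ (e ∘ v) ↔ Sat c φ v := by
  induction φ with
  | mem i j => intro v; exact hmem _ _
  | eq i j => intro v; exact he.1.eq_iff
  | nand φ ψ ih1 ih2 => intro v; simp [sat_nand, ih1, ih2]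
  | all k φ ih =>
    intro v
    simp only [sat_all, he.2.forall, ← ih, Function.comp_update]

/-- Truth in the universe. -/
abbrev Holds (φ : Fm) (v : ℕ → ZFSet.{0}) : Prop := Sat id φ v

/-- The formula has the same truth value in every transitive class containing its parameters. -/
def Absolute (φ : Fm) : Prop :=
  ∀ {M : Type 1} (c : M → ZFSet.{0}), Function.Injective c → (∀ x, ∀ z ∈ c x, ∃ y, c y = z) →
    ∀ v, Sat c φ v ↔ Fm.Holds φ (c ∘ v)

end Fm

open Fm

/-! ### Translations between the two kinds of formulas -/

/-- The number naming a variable: free variables become `0`. -/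
def varName {α : Type} {n : ℕ} : LSet.Term (α ⊕ Fin n) → ℕ
  | .var (.inl _) => 0
  | .var (.inr k) => k + 1
  | .func f _ => f.elim

/-- The named version of a formula with at most one free variable. -/
def toFm {α : Type} : ∀ {n : ℕ}, LSet.BoundedFormula α n → Fm
  | _, .falsum => neg (Fm.eq 0 0)
  | _, .equal t₁ t₂ => Fm.eq (varName t₁) (varName t₂)
  | _, .rel .adj ts => Fm.mem (varName (ts 0)) (varName (ts 1))
  | _, .imp φ ψ => Fm.imp (toFm φ) (toFm ψ)
  | n, .all φ => Fm.all (n + 1) (toFm φ)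

/-- The standard version of a formula with named variables, with `ρ` interpreting the names. -/
def ofFm : Fm → ∀ {n : ℕ}, (ℕ → ℕ ⊕ Fin n) → LSet.BoundedFormula ℕ n
  | .mem i j, _, ρ => memBF (.var (ρ i)) (.var (ρ j))
  | .eq i j, _, ρ => .equal (.var (ρ i)) (.var (ρ j))
  | .nand φ ψ, _, ρ => (ofFm φ ρ ⊓ ofFm ψ ρ).not
  | .all i φ, n, ρ =>
    (ofFm φ (Function.update (fun k => (ρ k).map id Fin.castSucc) i (.inr (Fin.last n)))).all

section Translation

variable {M : Type 1} [LSet.Structure M] {c : M → ZFSet.{0}}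

/-- The relation of the structure `M` is membership of the sets named by `c`. -/
def IsMemStructure (c : M → ZFSet.{0}) : Prop :=
  Function.Injective c ∧ ∀ xs : Fin 2 → M,
    Structure.RelMap (L := LSet) Language.adj xs ↔ c (xs 0) ∈ c (xs 1)

theorem realize_varName {α : Type} {n : ℕ} (t : LSet.Term (α ⊕ Fin n)) {v : ℕ → M} {a : M}
    {xs : Fin n → M} (h0 : v 0 = a) (hx : ∀ k : Fin n, v (k + 1) = xs k) :
    t.realize (Sum.elim (fun _ => a) xs) = v (varName t) := by
  rcases t with (_ | k) | ⟨f, _⟩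
  · simp [varName, h0]
  · simp [varName, hx]
  · exact f.elim

theorem sat_toFm (hc : IsMemStructure c) {α : Type} {n : ℕ} (φ : LSet.BoundedFormula α n) :
    ∀ {v : ℕ → M} {a : M} {xs : Fin n → M}, v 0 = a → (∀ k : Fin n, v (k + 1) = xs k) →
      (Sat c (toFm φ) v ↔ φ.Realize (fun _ => a) xs) := by
  induction φ with
  | falsum => intros; simp [toFm, BoundedFormula.Realize]
  | equal t₁ t₂ =>
    intro v a xs h0 hx
    simp [toFm, BoundedFormula.Realize, realize_varName _ h0 hx]
  | rel R ts =>
    intro v a xs h0 hx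
    cases R
    simp only [toFm, BoundedFormula.Realize, sat_mem, realize_varName _ h0 hx]
    exact (hc.2 fun i => v (varName (ts i))).symm
  | imp φ ψ ih1 ih2 =>
    intro v a xs h0 hx
    simp [toFm, ih1 h0 hx, ih2 h0 hx]
  | @all n φ ih =>
    intro v a xs h0 hx
    simp only [toFm, sat_all, BoundedFormula.realize_all]
    refine forall_congr' fun x => ih (by simp [h0]) fun k => ?_
    induction k using Fin.lastCases with
    | last => simp
    | cast k => simp [hx, k.2.ne]

theorem realize_ofFm (hc : IsMemStructure c) (φ : Fm) :
    ∀ {n : ℕ} {ρ : ℕ → ℕ ⊕ Fin n} {v w : ℕ → M} {xs : Fin n → M},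
      (∀ i, v i = Sum.elim w xs (ρ i)) → ((ofFm φ ρ).Realize w xs ↔ Sat c φ v) := by
  induction φ with
  | mem i j =>
    intro n ρ v w xs h
    simp only [ofFm, memBF, Relations.boundedFormula₂, sat_mem, h]
    exact hc.2 _
  | eq i j =>
    intro n ρ v w xs h
    simp [ofFm, BoundedFormula.Realize, h]
  | nand φ ψ ih1 ih2 =>
    intro n ρ v w xs h
    simp [ofFm, sat_nand, ih1 h, ih2 h]
  | all k φ ih =>
    intro n ρ v w xs h
    simp only [ofFm, sat_all, BoundedFormula.realize_all]
    refine forall_congr' fun x => ih fun i => ?_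
    by_cases hik : i = k
    · subst hik; simp
    · simp only [Function.update_of_ne hik, h]
      rcases ρ i with a | a <;> simp

theorem sat_elementary {M' : Type 1} [LSet.Structure M'] {c' : M' → ZFSet.{0}}
    (hc : IsMemStructure c) (hc' : IsMemStructure c') (e : M ↪ₑ[LSet] M') (φ : Fm) (v : ℕ → M) :
    Sat c' φ (e ∘ v) ↔ Sat c φ v := by
  rw [← realize_ofFm hc (n := 0) (ρ := Sum.inl) (v := v) (w := v) (xs := Fin.elim0) φ (by simp),
    ← realize_ofFm hc' (n := 0) (ρ := Sum.inl) (v := e ∘ v) (w := e ∘ v) (xs := e ∘ Fin.elim0) φ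
      (by simp)]
  exact e.map_boundedFormula _ _ _

end Translation

/-! ### Prenex normal forms -/

theorem varName_le {α : Type} {n : ℕ} (t : LSet.Term (α ⊕ Fin n)) : varName t ≤ n := by
  rcases t with (_ | k) | ⟨f, _⟩
  · simp [varName]
  · exact k.2
  · exact f.elim

theorem varName_relabel {α : Type} {n : ℕ} (t : LSet.Term (α ⊕ Fin n)) :
    varName (t.relabel (Sum.map id Fin.castSucc) : LSet.Term (α ⊕ Fin (n + 1))) = varName t := by
  rcases t with (_ | k) | ⟨f, _⟩
  · simp [varName]
  · simp [varName]
  · exact f.elim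

theorem varName_last {α : Type} {n : ℕ} :
    varName (Term.var (Sum.inr (Fin.last n)) : LSet.Term (α ⊕ Fin (n + 1))) = n + 1 := rfl

/-- Two assignments agree on the variables up to `p`. -/
def Agree {M : Type 1} (p : ℕ) (v w : ℕ → M) : Prop := ∀ i ≤ p, v i = w i

theorem sat_toFm_congr {M : Type 1} {c : M → ZFSet.{0}} {α : Type} {n : ℕ}
    (φ : LSet.BoundedFormula α n) :
    ∀ {v w : ℕ → M}, Agree n v w → (Sat c (toFm φ) v ↔ Sat c (toFm φ) w) := by
  induction φ with
  | falsum => intros; simp [toFm]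
  | equal t₁ t₂ =>
    intro v w h
    simp [toFm, h _ (varName_le _)]
  | rel R ts =>
    intro v w h
    cases R
    simp [toFm, h _ (varName_le _)]
  | imp φ ψ ih1 ih2 =>
    intro v w h
    simp [toFm, ih1 h, ih2 h]
  | @all n φ ih =>
    intro v w h
    refine forall_congr' fun x => ih fun i hi => ?_
    by_cases hi' : i = n + 1
    · subst hi'; simp
    · simp [hi', h i (by omega)]

theorem sat_toFm_ex {M : Type 1} {c : M → ZFSet.{0}} {α : Type} {n : ℕ}
    (φ : LSet.BoundedFormula α (n + 1)) (v : ℕ → M) :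
    Sat c (toFm φ.ex) v ↔ ∃ x, Sat c (toFm φ) (Function.update v (n + 1) x) := by
  simp [toFm]

theorem sat_toFm_inf {M : Type 1} {c : M → ZFSet.{0}} {α : Type} {n : ℕ}
    (φ ψ : LSet.BoundedFormula α n) (v : ℕ → M) :
    Sat c (toFm (φ ⊓ ψ)) v ↔ Sat c (toFm φ) v ∧ Sat c (toFm ψ) v := by
  show Sat c (toFm ((φ.imp (ψ.imp .falsum)).imp .falsum)) v ↔ _
  simp [toFm]

/-- Formulas obtained from those in `B` by a block of existential quantifiers. -/
inductive ExBlock {α : Type} (B : ∀ n : ℕ, LSet.BoundedFormula α n → Prop) :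
    ∀ n : ℕ, LSet.BoundedFormula α n → Prop
  | base {n φ} : B n φ → ExBlock B n φ
  | ex {n φ} : ExBlock B (n + 1) φ → ExBlock B n φ.ex

/-- Formulas obtained from those in `B` by a block of universal quantifiers. -/
inductive AllBlock {α : Type} (B : ∀ n : ℕ, LSet.BoundedFormula α n → Prop) :
    ∀ n : ℕ, LSet.BoundedFormula α n → Prop
  | base {n φ} : B n φ → AllBlock B n φ
  | all {n φ} : AllBlock B (n + 1) φ → AllBlock B n φ.all

theorem IsSigmaFml.exBlock {α : Type} {k n : ℕ} {φ : LSet.BoundedFormula α n}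
    (h : IsSigmaFml (k + 1) φ) : ExBlock (fun _ ψ => IsPiFml k ψ) n φ := by
  have key : ∀ {m : ℕ} {α : Type} {n : ℕ} {φ : LSet.BoundedFormula α n}, IsSigmaFml m φ →
      ∀ k, m = k + 1 → ExBlock (fun _ ψ => IsPiFml k ψ) n φ := by
    intro m α n φ h
    refine IsSigmaFml.rec
      (motive_1 := fun m α n φ _ => ∀ k, m = k + 1 → ExBlock (fun _ ψ => IsPiFml k ψ) n φ)
      (motive_2 := fun _ _ _ _ _ => _root_.True) ?_ ?_ ?_ ?_ ?_ ?_ h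
    · intro k α n φ h k' _
      exact .base (.of_delta0 h)
    · intro k α n φ h _ k' hk
      obtain rfl : k = k' := by omega
      exact .base h
    · intro k α n φ h ih k' hk
      exact .ex (ih k' hk)
    all_goals intros; trivial
  exact key h k rfl

theorem IsPiFml.allBlock {α : Type} {k n : ℕ} {φ : LSet.BoundedFormula α n}
    (h : IsPiFml (k + 1) φ) : AllBlock (fun _ ψ => IsSigmaFml k ψ) n φ := by
  have key : ∀ {m : ℕ} {α : Type} {n : ℕ} {φ : LSet.BoundedFormula α n}, IsPiFml m φ →
      ∀ k, m = k + 1 → AllBlock (fun _ ψ => IsSigmaFml k ψ) n φ := by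
    intro m α n φ h
    refine IsPiFml.rec
      (motive_2 := fun m α n φ _ => ∀ k, m = k + 1 → AllBlock (fun _ ψ => IsSigmaFml k ψ) n φ)
      (motive_1 := fun _ _ _ _ _ => _root_.True) ?_ ?_ ?_ ?_ ?_ ?_ h
    rotate_left 3
    · intro k α n φ h k' _
      exact .base (.of_delta0 h)
    · intro k α n φ h _ k' hk
      obtain rfl : k = k' := by omega
      exact .base h
    · intro k α n φ h ih k' hk
      exact .all (ih k' hk)
    all_goals intros; trivial
  exact key h k rfl

theorem IsPiFml.delta0 {α : Type} {n : ℕ} {φ : LSet.BoundedFormula α n}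
    (h : IsPiFml 0 φ) : IsDelta0 φ := by
  cases h
  assumption

theorem ExBlock.normalForm {α : Type} {B : ∀ n : ℕ, LSet.BoundedFormula α n → Prop} {n : ℕ}
    {φ : LSet.BoundedFormula α n} (h : ExBlock B n φ) :
    ∃ (m : ℕ) (ψ : LSet.BoundedFormula α m), B m ψ ∧ ∀ {M : Type 1} (c : M → ZFSet.{0}) v,
      Sat c (toFm φ) v ↔ ∃ w, Agree n w v ∧ Sat c (toFm ψ) w := by
  induction h with
  | @base n φ h =>
    refine ⟨n, φ, h, fun c v => ⟨fun H => ⟨v, fun _ _ => rfl, H⟩, ?_⟩⟩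
    rintro ⟨w, hw, H⟩
    exact (sat_toFm_congr φ hw).1 H
  | @ex n φ h ih =>
    obtain ⟨m, ψ, hψ, H⟩ := ih
    refine ⟨m, ψ, hψ, fun c v => ?_⟩
    simp only [sat_toFm_ex, H]
    constructor
    · rintro ⟨x, w, hw, hs⟩
      refine ⟨w, fun i hi => ?_, hs⟩
      rw [hw i (by omega), Function.update_of_ne (by omega)]
    · rintro ⟨w, hw, hs⟩
      refine ⟨w (n + 1), w, fun i hi => ?_, hs⟩
      by_cases hi' : i = n + 1
      · subst hi'; simp
      · rw [Function.update_of_ne hi', hw i (by omega)]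

theorem AllBlock.normalForm {α : Type} {B : ∀ n : ℕ, LSet.BoundedFormula α n → Prop} {n : ℕ}
    {φ : LSet.BoundedFormula α n} (h : AllBlock B n φ) :
    ∃ (m : ℕ) (ψ : LSet.BoundedFormula α m), B m ψ ∧ ∀ {M : Type 1} (c : M → ZFSet.{0}) v,
      Sat c (toFm φ) v ↔ ∀ w, Agree n w v → Sat c (toFm ψ) w := by
  induction h with
  | @base n φ h =>
    refine ⟨n, φ, h, fun c v => ⟨fun H w hw => (sat_toFm_congr φ hw).2 H, fun H => ?_⟩⟩
    exact H v fun _ _ => rfl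
  | @all n φ h ih =>
    obtain ⟨m, ψ, hψ, H⟩ := ih
    refine ⟨m, ψ, hψ, fun c v => ?_⟩
    simp only [toFm, sat_all, H]
    constructor
    · intro hs w hw
      refine hs (w (n + 1)) w fun i hi => ?_
      by_cases hi' : i = n + 1
      · subst hi'; simp
      · rw [Function.update_of_ne hi', hw i (by omega)]
    · intro hs x w hw
      refine hs w fun i hi => ?_
      rw [hw i (by omega), Function.update_of_ne (by omega)]

theorem IsDelta0.absolute {α : Type} {n : ℕ} {φ : LSet.BoundedFormula α n} (h : IsDelta0 φ) :
    (toFm φ).Absolute := by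
  have hball : ∀ {α : Type} {n : ℕ} (t : LSet.Term (α ⊕ Fin n)) {φ : LSet.BoundedFormula α (n + 1)}
      {M : Type 1} (c : M → ZFSet.{0}), Function.Injective c →
      (∀ x, ∀ z ∈ c x, ∃ y, c y = z) → (toFm φ).Absolute → ∀ (v : ℕ → M) x,
      (Sat c (toFm φ) (Function.update v (n + 1) x) ↔
        Holds (toFm φ) (Function.update (c ∘ v) (n + 1) (c x))) := by
    intro α n t φ M c hc ht ih v x
    rw [ih c hc ht, Function.comp_update]
  induction h with
  | of_isQF h =>
    intro M c hc ht v
    induction h with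
    | falsum => simp [toFm]
    | of_isAtomic h =>
      cases h with
      | equal t₁ t₂ => simp [toFm, Term.bdEqual, hc.eq_iff]
      | rel R ts => cases R; simp [toFm, Relations.boundedFormula]
    | imp _ _ ih1 ih2 => simp [toFm, ih1, ih2]
  | imp _ _ ih1 ih2 =>
    intro M c hc ht v
    simp [toFm, ih1 c hc ht, ih2 c hc ht]
  | @ball n t φ _ ih =>
    intro M c hc ht v
    have hne : varName t ≠ n + 1 := by have := varName_le t; omega
    simp only [toFm, memBF, Relations.boundedFormula₂, Relations.boundedFormula, sat_all, sat_imp,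
      sat_mem, Matrix.cons_val_zero, Matrix.cons_val_one, varName_relabel, varName_last,
      Function.update_self, Function.update_of_ne hne, hball t c hc ht ih]
    constructor
    · intro H z hz
      obtain ⟨x, rfl⟩ := ht _ z hz
      exact H x hz
    · intro H x hx
      exact H _ hx
  | @bex n t φ _ ih =>
    intro M c hc ht v
    have hne : varName t ≠ n + 1 := by have := varName_le t; omega
    simp only [sat_toFm_ex, sat_toFm_inf]
    simp only [toFm, memBF, Relations.boundedFormula₂, Relations.boundedFormula,
      sat_mem, Matrix.cons_val_zero, Matrix.cons_val_one, varName_relabel, varName_last,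
      Function.update_self, Function.update_of_ne hne, hball t c hc ht ih]
    constructor
    · rintro ⟨x, hx, H⟩
      exact ⟨c x, hx, H⟩
    · rintro ⟨z, hz, H⟩
      obtain ⟨x, rfl⟩ := ht _ z hz
      exact ⟨x, hz, H⟩

/-- Normal form of `Σ₃` formulas, with the blocks of quantifiers read as quantifiers over
assignments. -/
theorem IsSigmaFml.normalForm {α : Type} {φ : LSet.BoundedFormula α 0} (h : IsSigmaFml 3 φ) :
    ∃ (χ δ : Fm) (p q : ℕ), δ.Absolute ∧
      (∀ {M : Type 1} (c : M → ZFSet.{0}) v,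
        Sat c (toFm φ) v ↔ ∃ w, Agree 0 w v ∧ Sat c χ w) ∧
      ∀ {M : Type 1} (c : M → ZFSet.{0}) v,
        Sat c χ v ↔ ∀ w, Agree p w v → ∃ u, Agree q u w ∧ Sat c δ u := by
  obtain ⟨p, χ, hχ, H1⟩ := h.exBlock.normalForm
  obtain ⟨q, ψ, hψ, H2⟩ := hχ.allBlock.normalForm
  obtain ⟨r, δ, hδ, H3⟩ := hψ.exBlock.normalForm
  exact ⟨toFm χ, toFm δ, p, q, hδ.delta0.absolute, H1, fun c v => by simp only [H2, H3]⟩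

/-! ### The Mostowski collapse -/

/-- The Mostowski collapse of `x` relative to the class `N`. -/
noncomputable def collapse (N : Set ZFSet.{0}) (x : ZFSet.{0}) : ZFSet.{0} :=
  ZFSet.range fun y : ↥(x.sep (· ∈ N)) => collapse N y
termination_by x
decreasing_by exact (ZFSet.mem_sep.1 y.2).1

theorem mem_collapse {N : Set ZFSet.{0}} {x z : ZFSet.{0}} :
    z ∈ collapse N x ↔ ∃ y ∈ x, y ∈ N ∧ collapse N y = z := by
  rw [collapse, ZFSet.mem_range]
  constructor
  · rintro ⟨⟨y, hy⟩, rfl⟩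
    exact ⟨y, (ZFSet.mem_sep.1 hy).1, (ZFSet.mem_sep.1 hy).2, rfl⟩
  · rintro ⟨y, hy, hN, rfl⟩
    exact ⟨⟨y, ZFSet.mem_sep.2 ⟨hy, hN⟩⟩, rfl⟩

theorem collapse_injOn {N : Set ZFSet.{0}}
    (hN : ∀ x ∈ N, ∀ y ∈ N, (∀ z ∈ N, z ∈ x ↔ z ∈ y) → x = y) : Set.InjOn (collapse N) N := by
  intro x
  induction x using ZFSet.inductionOn with
  | _ x ih =>
    intro hx y hy h
    refine hN x hx y hy fun z hz => ⟨fun hzx => ?_, fun hzy => ?_⟩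
    · have : collapse N z ∈ collapse N y := h ▸ mem_collapse.2 ⟨z, hzx, hz, rfl⟩
      obtain ⟨w, hw, hwN, e⟩ := mem_collapse.1 this
      rwa [ih z hzx hz hwN e.symm]
    · have : collapse N z ∈ collapse N x := h ▸ mem_collapse.2 ⟨z, hzy, hz, rfl⟩
      obtain ⟨w, hw, hwN, e⟩ := mem_collapse.1 this
      rwa [← ih w hw hwN hz e]

theorem collapse_eq_self {N : Set ZFSet.{0}} {X : ZFSet.{0}} (hX : X.IsTransitive)
    (hXN : ∀ x ∈ X, x ∈ N) (x : ZFSet.{0}) : x ∈ X → collapse N x = x := by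
  induction x using ZFSet.inductionOn with
  | _ x ih =>
    intro hx
    ext z
    rw [mem_collapse]
    constructor
    · rintro ⟨y, hy, -, rfl⟩
      rwa [ih y hy (hX.mem_trans hy hx)]
    · intro hz
      have hzX := hX.mem_trans hz hx
      exact ⟨z, hz, hXN z hzX, ih z hz hzX⟩

theorem exists_rank_eq {M : Type 1} {c : M → ZFSet.{0}} (hc : ∀ x, ∀ z ∈ c x, ∃ y, c y = z)
    (x : M) (o : Ordinal.{0}) (ho : o ≤ (c x).rank) : ∃ y, (c y).rank = o := by
  suffices H : ∀ (t : ZFSet.{0}) (x : M), c x = t → o ≤ t.rank → ∃ y, (c y).rank = o from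
    H _ x rfl ho
  intro t
  induction t using ZFSet.inductionOn with
  | _ t ih =>
    intro x hx ho
    rcases ho.eq_or_lt with h | h
    · exact ⟨x, by rw [hx, h]⟩
    · obtain ⟨z, hz, hoz⟩ := ZFSet.lt_rank_iff.1 h
      obtain ⟨y, rfl⟩ := hc x z (hx ▸ hz)
      exact ih _ hz y rfl hoz

theorem isMemStructure_Vt (α : Ordinal.{0}) : IsMemStructure (Subtype.val : Vt α → ZFSet.{0}) :=
  ⟨Subtype.val_injective, fun _ => Iff.rfl⟩

theorem isMemStructure_id : IsMemStructure (id : ZFSet.{0} → ZFSet.{0}) :=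
  ⟨Function.injective_id, fun _ => Iff.rfl⟩

theorem Vt_transitive {α : Ordinal.{0}} (x : Vt α) (z : ZFSet.{0}) (hz : z ∈ x.1) :
    ∃ y : Vt α, y.1 = z :=
  ⟨⟨z, (ZFSet.rank_lt_of_mem hz).trans x.2⟩, rfl⟩

/-- Uncountable cardinals `γ` such that every `V_ρ` with `ρ < γ` has cardinality below `γ`. -/
structure IsBethLimit (γ : Ordinal.{0}) : Prop where
  isCard : γ.card.ord = γ
  omega_lt : Ordinal.omega0 < γ
  card_lt : ∀ ρ < γ, (ZFSet.vonNeumann ρ).card < γ.card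

theorem IsBethLimit.isSuccLimit {γ : Ordinal.{0}} (h : IsBethLimit γ) : Order.IsSuccLimit γ := by
  rw [← h.isCard]
  exact Cardinal.isSuccLimit_ord (by simpa using Ordinal.card_le_card h.omega_lt.le)

/-- The downward Löwenheim–Skolem argument: `V_γ` is correct about `Σ₁` statements. -/
theorem IsBethLimit.exists_agree {γ : Ordinal.{0}} (hγ : IsBethLimit γ) {δ : Fm} (hδ : δ.Absolute)
    {q : ℕ} {v : ℕ → ZFSet.{0}} (hq : ∀ i ≤ q, (v i).rank < γ) (hv : Holds δ v) :
    ∃ w : ℕ → Vt γ, Agree q (fun i => (w i).1) v ∧ Sat Subtype.val δ w := by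
  obtain ⟨ρ, hργ, hωρ, hρ⟩ : ∃ ρ < γ, Ordinal.omega0 ≤ ρ ∧ ∀ i ≤ q, (v i).rank < ρ := by
    refine ⟨max Ordinal.omega0 ((Finset.range (q + 1)).sup fun i => Order.succ (v i).rank),
      max_lt hγ.omega_lt ((Finset.sup_lt_iff (bot_lt_of_lt hγ.omega_lt)).2 fun i hi =>
        hγ.isSuccLimit.succ_lt (hq i (by simpa [Nat.lt_succ_iff] using hi))), le_max_left _ _,
      fun i hi => lt_max_of_lt_right (lt_of_lt_of_le (Order.lt_succ _)
        (Finset.le_sup (f := fun i => Order.succ (v i).rank) (by simpa [Nat.lt_succ_iff])))⟩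
  obtain ⟨l, hl, hρl⟩ : ∃ l, (∀ i, (v i).rank < l) ∧ ρ ≤ l := by
    refine ⟨max ρ (⨆ i, Order.succ (v i).rank), fun i => lt_max_of_lt_right ?_, le_max_left _ _⟩
    exact lt_of_lt_of_le (Order.lt_succ _) (Ordinal.le_iSup (fun i => Order.succ (v i).rank) i)
  let v' : ℕ → Vt l := fun i => ⟨v i, hl i⟩
  have hv' : Sat Subtype.val δ v' :=
    (hδ Subtype.val Subtype.val_injective Vt_transitive v').2 hv
  set μ : Cardinal.{1} := Cardinal.mk ↥(ZFSet.vonNeumann ρ) with hμ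
  have hμ0 : Cardinal.aleph0 ≤ μ := by
    rw [hμ, ZFSet.cardinalMk_coe_sort, Cardinal.aleph0_le_lift]
    refine le_trans ?_ (Ordinal.card_le_card_vonNeumann ρ)
    simpa using Ordinal.card_le_card hωρ
  let X : Set (Vt l) := {x | x.1.rank < ρ} ∪ Set.range v'
  have hX : Cardinal.mk X ≤ μ := by
    refine (Cardinal.mk_union_le _ _).trans (Cardinal.add_le_of_le hμ0 ?_ ?_)
    · refine Cardinal.mk_le_of_injective
        (f := fun x => (⟨x.1.1, ZFSet.mem_vonNeumann.2 x.2⟩ : ↥(ZFSet.vonNeumann ρ))) ?_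
      intro x y h
      exact Subtype.ext (Subtype.ext (Subtype.ext_iff.1 h :))
    · exact le_trans (Set.countable_range v').le_aleph0 hμ0
  have hμl : μ ≤ Cardinal.mk (Vt l) := by
    refine Cardinal.mk_le_of_injective
      (f := fun x => (⟨x.1, (ZFSet.mem_vonNeumann.1 x.2).trans_le hρl⟩ : Vt l)) ?_
    intro x y h
    exact Subtype.ext (Subtype.ext_iff.1 h :)
  obtain ⟨S, hXS, hS⟩ := exists_elementarySubstructure_card_eq LSet X μ hμ0
    (by simpa using hX) (by
      rw [Cardinal.lift_id'.{0, 1}]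
      refine le_trans ?_ hμ0
      have h1 : ∀ n, Countable (LSet.Functions n) := fun _ => inferInstanceAs (Countable Empty)
      have h2 : ∀ n, Countable (LSet.Relations n) := fun _ => inferInstance
      have h3 : Countable LSet.Symbols := inferInstanceAs (Countable (_ ⊕ _))
      rw [Cardinal.lift_le_aleph0]
      exact Cardinal.mk_le_aleph0_iff.2 h3) (by simpa using hμl)
  rw [Cardinal.lift_id, Cardinal.lift_id] at hS
  let c : S → ZFSet.{0} := fun x => x.1.1
  have hc : IsMemStructure c :=
    ⟨fun x y h => Subtype.ext (Subtype.ext h), fun _ => Iff.rfl⟩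
  let N : Set ZFSet.{0} := Set.range c
  have hN : ∀ x ∈ N, ∀ y ∈ N, (∀ z ∈ N, z ∈ x ↔ z ∈ y) → x = y := by
    rintro _ ⟨x, rfl⟩ _ ⟨y, rfl⟩ h
    let ext : Fm := .imp (.all 2 (.iff (.mem 2 0) (.mem 2 1))) (.eq 0 1)
    let u : ℕ → S := fun i => if i = 0 then x else y
    have := (sat_elementary hc (isMemStructure_Vt l) S.subtype ext u).1 (by
      simp only [ext, sat_imp, sat_all, sat_iff, sat_mem, sat_eq]
      intro H
      refine Subtype.ext (ZFSet.ext fun z => ⟨fun hz => ?_, fun hz => ?_⟩)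
      · obtain ⟨z, rfl⟩ := Vt_transitive _ z hz
        simpa using (H z).1 (by simpa using hz)
      · obtain ⟨z, rfl⟩ := Vt_transitive _ z hz
        simpa using (H z).2 (by simpa using hz))
    simp only [ext, sat_imp, sat_all, sat_iff, sat_mem, sat_eq] at this
    have e := this fun z => by simpa [u] using h (c z) ⟨z, rfl⟩
    simp only [u, if_true, one_ne_zero, if_false] at e
    rw [e]
  let c' : S → ZFSet.{0} := fun x => collapse N (c x)
  have hc' : Function.Injective c' := fun x y h => hc.1 (collapse_injOn hN ⟨x, rfl⟩ ⟨y, rfl⟩ h)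
  have hmem : ∀ x y, c' x ∈ c' y ↔ c x ∈ c y := by
    intro x y
    constructor
    · intro h
      obtain ⟨z, hz, hzN, e⟩ := mem_collapse.1 h
      rwa [← collapse_injOn hN hzN ⟨x, rfl⟩ e]
    · intro h
      exact mem_collapse.2 ⟨_, h, ⟨x, rfl⟩, rfl⟩
  have htr : ∀ x, ∀ z ∈ c' x, ∃ y, c' y = z := by
    intro x z hz
    obtain ⟨_, -, ⟨y, rfl⟩, rfl⟩ := mem_collapse.1 hz
    exact ⟨y, rfl⟩
  have hrank : ∀ x, (c' x).rank < γ := by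
    intro x
    by_contra! hx
    choose f hf using fun o : Set.Iio γ => exists_rank_eq htr x o.1 (o.2.le.trans hx)
    have hinj : Function.Injective f := fun o o' h => Subtype.ext (by rw [← hf o, ← hf o', h])
    have := Cardinal.mk_le_of_injective hinj
    rw [hS, hμ, ZFSet.cardinalMk_coe_sort, Cardinal.mk_Iio_ordinal, Cardinal.lift_le] at this
    exact this.not_gt (hγ.card_lt ρ hργ)
  let u : ℕ → S := fun i => ⟨v' i, hXS (.inr ⟨i, rfl⟩)⟩
  have hu : Sat c δ u := (sat_elementary hc (isMemStructure_Vt l) S.subtype δ u).1 hv'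
  have hu' : Sat c' δ u := (sat_embed (c := c) id Function.bijective_id hmem δ u).2 hu
  refine ⟨fun i => ⟨c' (u i), hrank _⟩, fun i hi => ?_, ?_⟩
  · refine collapse_eq_self (ZFSet.isTransitive_vonNeumann ρ) (fun x hx => ?_) _
      (ZFSet.mem_vonNeumann.2 (hρ i hi))
    have hx := ZFSet.mem_vonNeumann.1 hx
    exact ⟨⟨⟨x, hx.trans_le hρl⟩, hXS (.inl hx)⟩, rfl⟩
  · exact (hδ Subtype.val Subtype.val_injective Vt_transitive _).2 ((hδ c' hc' htr u).1 hu')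

/-! ### Basic formulas of set theory -/

/-- The class named by `c` is transitive and closed under unordered pairs. -/
structure PairClosed {M : Type 1} (c : M → ZFSet.{0}) : Prop where
  injective : Function.Injective c
  transitive : ∀ x, ∀ z ∈ c x, ∃ y, c y = z
  pair : ∀ x y, ∃ z, c z = {c x, c y}

namespace Fm

/-- The formula `x_w = {x_i, x_j}`. -/
def isUPair (w i j : ℕ) : Fm :=
  all (w + i + j + 1) (iff (mem (w + i + j + 1) w)
    (or (eq (w + i + j + 1) i) (eq (w + i + j + 1) j)))

/-- The formula `x_z = (x_i, x_j)`. -/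
def isPair (z i j : ℕ) : Fm :=
  all (z + i + j + 1) (iff (mem (z + i + j + 1) z)
    (or (isUPair (z + i + j + 1) i i) (isUPair (z + i + j + 1) i j)))

/-- The formula `(x_i, x_j) ∈ x_r`. -/
def pmem (i j r : ℕ) : Fm := bex (i + j + r + 1) r (isPair (i + j + r + 1) i j)

/-- The formula `x_i ⊆ x_j`. -/
def isSub (i j : ℕ) : Fm := ball (i + j + 1) i (mem (i + j + 1) j)

/-- The formula stating that `x_i` is transitive. -/
def isTrans (i : ℕ) : Fm := ball (i + 1) i (isSub (i + 1) i)

/-- The formula stating that `x_i` is an ordinal. -/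
def isOrd (i : ℕ) : Fm := and (isTrans i) (ball (i + 1) i (isTrans (i + 1)))

end Fm

namespace PairClosed

variable {M : Type 1} {c : M → ZFSet.{0}} {v : ℕ → M} {w i j r z : ℕ}

theorem sat_isUPair (hc : PairClosed c) :
    Sat c (isUPair w i j) v ↔ c (v w) = {c (v i), c (v j)} := by
  simp only [isUPair, sat_all, sat_iff, sat_mem, sat_or, sat_eq, Function.update_self,
    Function.update_of_ne (show w ≠ w + i + j + 1 by omega),
    Function.update_of_ne (show i ≠ w + i + j + 1 by omega),
    Function.update_of_ne (show j ≠ w + i + j + 1 by omega)]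
  constructor
  · intro H
    ext t
    rw [ZFSet.mem_pair]
    constructor
    · intro ht
      obtain ⟨x, rfl⟩ := hc.transitive _ _ ht
      exact ((H x).1 ht).imp (congrArg c) (congrArg c)
    · rintro (rfl | rfl)
      · exact (H _).2 (.inl rfl)
      · exact (H _).2 (.inr rfl)
  · intro H x
    rw [H, ZFSet.mem_pair, hc.injective.eq_iff, hc.injective.eq_iff]

theorem sat_isPair (hc : PairClosed c) :
    Sat c (isPair z i j) v ↔ c (v z) = ZFSet.pair (c (v i)) (c (v j)) := by
  simp only [isPair, sat_all, sat_iff, sat_mem, sat_or, hc.sat_isUPair, Function.update_self,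
    Function.update_of_ne (show z ≠ z + i + j + 1 by omega),
    Function.update_of_ne (show i ≠ z + i + j + 1 by omega),
    Function.update_of_ne (show j ≠ z + i + j + 1 by omega)]
  have hs : ({c (v i), c (v i)} : ZFSet) = {c (v i)} := by ext; simp
  rw [hs]
  constructor
  · intro H
    ext t
    rw [ZFSet.pair, ZFSet.mem_pair]
    constructor
    · intro ht
      obtain ⟨x, rfl⟩ := hc.transitive _ _ ht
      exact (H x).1 ht
    · rintro (rfl | rfl)
      · obtain ⟨x, hx⟩ := hc.pair (v i) (v i)
        rw [hs] at hx
        exact hx ▸ (H x).2 (.inl hx)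
      · obtain ⟨x, hx⟩ := hc.pair (v i) (v j)
        exact hx ▸ (H x).2 (.inr hx)
  · intro H x
    rw [H, ZFSet.pair, ZFSet.mem_pair]

theorem sat_pmem (hc : PairClosed c) :
    Sat c (pmem i j r) v ↔ ZFSet.pair (c (v i)) (c (v j)) ∈ c (v r) := by
  simp only [pmem, sat_bex, hc.sat_isPair, Function.update_self,
    Function.update_of_ne (show r ≠ i + j + r + 1 by omega),
    Function.update_of_ne (show i ≠ i + j + r + 1 by omega),
    Function.update_of_ne (show j ≠ i + j + r + 1 by omega)]
  constructor
  · rintro ⟨x, hx, e⟩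
    rwa [← e]
  · intro H
    obtain ⟨x, hx⟩ := hc.transitive _ _ H
    exact ⟨x, hx ▸ H, hx⟩

theorem sat_isSub (hc : PairClosed c) : Sat c (isSub i j) v ↔ c (v i) ⊆ c (v j) := by
  simp only [isSub, sat_ball, sat_mem, Function.update_self,
    Function.update_of_ne (show i ≠ i + j + 1 by omega),
    Function.update_of_ne (show j ≠ i + j + 1 by omega)]
  constructor
  · intro H t ht
    obtain ⟨x, rfl⟩ := hc.transitive _ _ ht
    exact H x ht
  · intro H x hx
    exact H hx

theorem sat_isTrans (hc : PairClosed c) : Sat c (isTrans i) v ↔ (c (v i)).IsTransitive := by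
  simp only [isTrans, sat_ball, hc.sat_isSub, Function.update_self,
    Function.update_of_ne (show i ≠ i + 1 by omega)]
  constructor
  · intro H t ht
    obtain ⟨x, rfl⟩ := hc.transitive _ _ ht
    exact H x ht
  · intro H x hx
    exact H _ hx

theorem sat_isOrd (hc : PairClosed c) : Sat c (isOrd i) v ↔ (c (v i)).IsOrdinal := by
  simp only [isOrd, sat_and, hc.sat_isTrans, sat_ball, Function.update_self,
    Function.update_of_ne (show i ≠ i + 1 by omega),
    ZFSet.isOrdinal_iff_forall_mem_isTransitive]
  refine and_congr_right fun _ => ⟨fun H t ht => ?_, fun H x hx => H _ hx⟩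
  obtain ⟨x, rfl⟩ := hc.transitive _ _ ht
  exact H x ht

end PairClosed

theorem pairClosed_Vt {α : Ordinal.{0}} (hα : Order.IsSuccLimit α) :
    PairClosed (Subtype.val : Vt α → ZFSet.{0}) where
  injective := Subtype.val_injective
  transitive := Vt_transitive
  pair x y := ⟨⟨{x.1, y.1}, by
    rw [ZFSet.rank_pair]
    exact max_lt (hα.succ_lt x.2) (hα.succ_lt y.2)⟩, rfl⟩

theorem rank_pair_lt {ρ : Ordinal.{0}} {x y : ZFSet.{0}} (hx : x.rank < ρ) (hy : y.rank < ρ) :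
    (ZFSet.pair x y).rank < Order.succ (Order.succ ρ) := by
  rw [Order.lt_succ_iff, ZFSet.rank_le_iff]
  intro z hz
  rw [Order.lt_succ_iff, ZFSet.rank_le_iff]
  rw [ZFSet.pair, ZFSet.mem_pair] at hz
  intro t ht
  rcases hz with rfl | rfl
  · rw [ZFSet.mem_singleton] at ht
    rwa [ht]
  · rw [ZFSet.mem_pair] at ht
    rcases ht with rfl | rfl <;> assumption

/-! ### Elementary extensions of inaccessible levels -/

theorem IsInaccOrd.isBethLimit {κ : Ordinal.{0}} (h : IsInaccOrd κ) : IsBethLimit κ where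
  isCard := h.2
  omega_lt := by
    rw [← h.2, ← Cardinal.ord_aleph0, Cardinal.ord_lt_ord]
    exact (Cardinal.isInaccessible_def.1 h.1).1
  card_lt ρ hρ := by
    rw [ZFSet.card_vonNeumann, ← h.1.preBeth_ord, h.2]
    exact Cardinal.preBeth_strictMono hρ

/-- The formula stating that every set can be injected into the ordinals. -/
def everySetInjects : Fm :=
  .all 0 (.ex 1 (.and (.ball 2 0 (.ex 3 (.and (isOrd 3) (pmem 2 3 1))))
    (.all 2 (.all 3 (.all 4 (.imp (pmem 2 4 1) (.imp (pmem 3 4 1) (.eq 2 3))))))))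

theorem sat_everySetInjects {α : Ordinal.{0}} (hα : Order.IsSuccLimit α) {v : ℕ → Vt α} :
    Sat Subtype.val everySetInjects v ↔ ∀ x : Vt α, ∃ f : Vt α,
      (∀ u : Vt α, u.1 ∈ x.1 → ∃ w : Vt α, w.1.IsOrdinal ∧ ZFSet.pair u.1 w.1 ∈ f.1) ∧
      ∀ u u' w : Vt α, ZFSet.pair u.1 w.1 ∈ f.1 → ZFSet.pair u'.1 w.1 ∈ f.1 → u = u' := by
  have hc := pairClosed_Vt hα
  simp [everySetInjects, hc.sat_pmem, hc.sat_isOrd]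

theorem IsBethLimit.everySetInjects {κ : Ordinal.{0}} (h : IsBethLimit κ) (v : ℕ → Vt κ) :
    Sat Subtype.val everySetInjects v := by
  rw [sat_everySetInjects h.isSuccLimit]
  rintro ⟨x, hx⟩
  set o := x.card.ord with ho
  have hoκ : o < κ := by
    rw [← h.isCard, ho, Cardinal.ord_lt_ord]
    refine lt_of_le_of_lt (ZFSet.card_mono (y := ZFSet.vonNeumann x.rank) ?_) (h.card_lt _ hx)
    exact ZFSet.subset_vonNeumann.2 le_rfl
  obtain ⟨e⟩ : Nonempty (↥x ≃ ↥o.toZFSet) := by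
    rw [← Cardinal.eq, ZFSet.cardinalMk_coe_sort, ZFSet.cardinalMk_coe_sort]
    simp [ho]
  have hw : ∀ u : ↥x, (e u : ZFSet).IsOrdinal ∧ (e u : ZFSet).rank < o := fun u =>
    ⟨(ZFSet.isOrdinal_toZFSet o).mem (e u).2, by simpa using ZFSet.rank_lt_of_mem (e u).2⟩
  have hpair : ∀ u : ↥x, (ZFSet.pair u (e u)).rank < Order.succ (Order.succ (max x.rank o)) :=
    fun u => rank_pair_lt (lt_max_of_lt_left (ZFSet.rank_lt_of_mem u.2))
      (lt_max_of_lt_right (hw u).2)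
  have hlim := h.isSuccLimit
  refine ⟨⟨ZFSet.range fun u : ↥x => ZFSet.pair u (e u), lt_of_le_of_lt (ZFSet.rank_le_iff.2 ?_)
    (hlim.succ_lt (hlim.succ_lt (max_lt hx hoκ)))⟩, ?_, ?_⟩
  · intro y hy
    obtain ⟨u, rfl⟩ := ZFSet.mem_range.1 hy
    exact hpair u
  · rintro u hu
    exact ⟨⟨e ⟨u, hu⟩, (hw _).2.trans hoκ⟩, (hw _).1, ZFSet.mem_range.2 ⟨⟨u, hu⟩, rfl⟩⟩
  · rintro u u' w h1 h2
    obtain ⟨t, ht⟩ := ZFSet.mem_range.1 h1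
    obtain ⟨t', ht'⟩ := ZFSet.mem_range.1 h2
    obtain ⟨a, b⟩ := ZFSet.pair_inj.1 ht
    obtain ⟨a', b'⟩ := ZFSet.pair_inj.1 ht'
    have : t = t' := e.injective (Subtype.ext (b.trans b'.symm))
    exact Subtype.ext (by rw [← a, ← a', this])

theorem VElem.sat_iff {α β : Ordinal.{0}} (h : VElem α β) (hαβ : α ≤ β) (φ : Fm) (v : ℕ → Vt α) :
    Sat Subtype.val φ (fun i => (⟨(v i).1, (v i).2.trans_le hαβ⟩ : Vt β)) ↔
      Sat Subtype.val φ v := by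
  obtain ⟨e, he⟩ := h
  rw [← sat_elementary (isMemStructure_Vt α) (isMemStructure_Vt β) e φ v]
  have : (e ∘ v) = fun i => (⟨(v i).1, (v i).2.trans_le hαβ⟩ : Vt β) :=
    funext fun i => Subtype.ext (he _)
  rw [this]

theorem VElem.isBethLimit {κ γ : Ordinal.{0}} (hκ : IsInaccOrd κ) (hγ : IsCardOrd γ) (hlt : κ < γ)
    (h : VElem κ γ) : IsBethLimit γ := by
  have hω := hκ.isBethLimit.omega_lt.trans hlt
  have hlim : Order.IsSuccLimit γ := by
    rw [← hγ]
    exact Cardinal.isSuccLimit_ord (by simpa using Ordinal.card_le_card hω.le)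
  refine ⟨hγ, hω, fun ρ hρ => ?_⟩
  let v : ℕ → Vt κ := fun _ => ⟨∅, by
    simpa using bot_lt_of_lt hκ.isBethLimit.omega_lt⟩
  have H := (sat_everySetInjects hlim).1
    ((h.sat_iff hlt.le _ v).2 (hκ.isBethLimit.everySetInjects v))
  obtain ⟨f, hf, hinj⟩ := H ⟨ZFSet.vonNeumann ρ, by rwa [ZFSet.rank_vonNeumann]⟩
  choose g hg hgf using fun u : ↥(ZFSet.vonNeumann ρ) =>
    hf ⟨u, (ZFSet.mem_vonNeumann.1 u.2).trans hρ⟩ u.2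
  have hrank : ∀ u, (g u).1.rank < f.1.rank := fun u => by
    refine lt_trans ?_ (ZFSet.rank_lt_of_mem (hgf u))
    exact (ZFSet.rank_lt_of_mem (ZFSet.mem_pair.2 (.inr rfl))).trans
      (ZFSet.rank_lt_of_mem (ZFSet.mem_pair.2 (.inr rfl)))
  have hle : Cardinal.mk ↥(ZFSet.vonNeumann ρ) ≤ Cardinal.mk (Set.Iio f.1.rank) := by
    refine Cardinal.mk_le_of_injective (f := fun u => ⟨(g u).1.rank, hrank u⟩) fun u u' e => ?_
    have e' : (g u) = g u' :=
      Subtype.ext (((hg u).rank_inj (hg u')).1 (Subtype.ext_iff.1 e :))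
    exact Subtype.ext (Subtype.ext_iff.1 (hinj _ _ _ (hgf u) (e' ▸ hgf u')) :)
  rw [ZFSet.cardinalMk_coe_sort, Cardinal.mk_Iio_ordinal, Cardinal.lift_le] at hle
  refine hle.trans_lt (Cardinal.lt_ord.1 ?_)
  rw [hγ]
  exact f.2

/-! ### Pseudo uplifting cardinals are `Σ₃`-reflecting -/

theorem exists_rank_lt (v : ℕ → ZFSet.{0}) : ∃ θ : Ordinal.{0}, ∀ i, (v i).rank < θ :=
  ⟨⨆ i, Order.succ (v i).rank, fun i =>
    lt_of_lt_of_le (Order.lt_succ _) (Ordinal.le_iSup (fun i => Order.succ (v i).rank) i)⟩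

theorem realize_iff_sat {M : Type 1} [LSet.Structure M] {c : M → ZFSet.{0}}
    (hc : IsMemStructure c) (φ : LSet.Formula (Fin 1)) (a : M) :
    φ.Realize (fun _ => a) ↔ Sat c (toFm φ) (fun _ => a) :=
  (sat_toFm hc φ (v := fun _ => a) (xs := default) rfl fun k => k.elim0).symm

theorem IsPseudoUplifting.exists_extension {κ : Ordinal.{0}} (h : IsPseudoUplifting κ)
    (θ : Ordinal.{0}) : ∃ γ, θ ≤ γ ∧ κ < γ ∧ IsBethLimit γ ∧ VElem κ γ := by
  obtain ⟨γ, hγ, hθ, hκ, he⟩ := h.2 θ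
  exact ⟨γ, hθ, hκ, he.isBethLimit h.1 hγ hκ, he⟩

theorem IsPseudoUplifting.sigmaReflecting {κ : Ordinal.{0}} (h : IsPseudoUplifting κ) :
    SigmaReflecting 3 κ := by
  refine ⟨h.1, fun φ hφ a ha => ?_⟩
  rw [realize_iff_sat isMemStructure_id, realize_iff_sat (isMemStructure_Vt κ)]
  obtain ⟨χ, δ, p, q, hδ, H1, H2⟩ := hφ.normalForm
  constructor
  · intro H
    obtain ⟨w, hw, hs⟩ := (H1 _ _).1 H
    obtain ⟨θ, hθ⟩ := exists_rank_lt w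
    obtain ⟨γ, hθγ, hκγ, hγ, he⟩ := h.exists_extension θ
    refine (he.sat_iff hκγ.le _ _).1 ((H1 _ _).2 ⟨fun i => ⟨w i, (hθ i).trans_le hθγ⟩,
      fun i hi => Subtype.ext (hw i hi), (H2 _ _).2 fun u hu => ?_⟩)
    obtain ⟨t, ht, hst⟩ := (H2 _ _).1 hs (fun i => (u i).1)
      fun i hi => (congrArg Subtype.val (hu i hi) :)
    obtain ⟨t', ht', hst'⟩ := hγ.exists_agree hδ (q := q)
      (fun i hi => by rw [ht i hi]; exact (u i).2) hst
    exact ⟨t', fun i hi => Subtype.ext ((ht' i hi).trans (ht i hi)), hst'⟩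
  · intro H
    obtain ⟨w, hw, hs⟩ := (H1 _ _).1 H
    refine (H1 _ _).2 ⟨fun i => (w i).1, fun i hi => (congrArg Subtype.val (hw i hi) :),
      (H2 _ _).2 fun u hu => ?_⟩
    obtain ⟨θ, hθ⟩ := exists_rank_lt u
    obtain ⟨γ, hθγ, hκγ, hγ, he⟩ := h.exists_extension θ
    obtain ⟨t, ht, hst⟩ := (H2 _ _).1 ((he.sat_iff hκγ.le _ _).2 hs)
      (fun i => ⟨u i, (hθ i).trans_le hθγ⟩) fun i hi => Subtype.ext (hu i hi)
    exact ⟨fun i => (t i).1, fun i hi => (congrArg Subtype.val (ht i hi) :),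
      (hδ _ Subtype.val_injective Vt_transitive t).1 hst⟩

/-! ### Codes for formulas and assignments -/

/-- The set coding the natural number `n`. -/
noncomputable def nm (n : ℕ) : ZFSet.{0} := (n : Ordinal.{0}).toZFSet

theorem nm_injective : Function.Injective nm := fun m n h => by
  have := congrArg ZFSet.rank h
  simpa [nm] using this

theorem rank_nm (n : ℕ) : (nm n).rank = n := by simp [nm]

/-- The set of codes of natural numbers. -/
noncomputable def nms : ZFSet.{0} := ZFSet.range nm

theorem mem_nms {x : ZFSet.{0}} : x ∈ nms ↔ ∃ n, nm n = x := ZFSet.mem_range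

theorem rank_nms : nms.rank = Ordinal.omega0 := by
  refine le_antisymm (ZFSet.rank_le_iff.2 fun x hx => ?_) (le_of_forall_lt fun o ho => ?_)
  · obtain ⟨n, rfl⟩ := mem_nms.1 hx
    rw [rank_nm]
    exact Ordinal.natCast_lt_omega0 n
  · obtain ⟨n, rfl⟩ := Ordinal.lt_omega0.1 ho
    rw [← rank_nm]
    exact ZFSet.rank_lt_of_mem (mem_nms.2 ⟨n, rfl⟩)

/-- The set of codes of natural numbers up to `p`. -/
noncomputable def nmsLe (p : ℕ) : ZFSet.{0} := ZFSet.range fun i : Fin (p + 1) => nm i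

theorem nm_mem_nmsLe {p n : ℕ} : nm n ∈ nmsLe p ↔ n ≤ p := by
  rw [nmsLe, ZFSet.mem_range]
  constructor
  · rintro ⟨i, hi⟩
    have := nm_injective hi
    omega
  · intro h
    exact ⟨⟨n, by omega⟩, rfl⟩

theorem nmsLe_subset (p : ℕ) : nmsLe p ⊆ nms := by
  intro x hx
  obtain ⟨i, rfl⟩ := ZFSet.mem_range.1 hx
  exact mem_nms.2 ⟨i, rfl⟩

/-- The set of coded triples `(f i, g i, h i)`. -/
noncomputable def tripleGraph {ι : Type} (f g h : ι → ℕ) : ZFSet.{0} :=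
  ZFSet.range fun i => ZFSet.pair (nm (f i)) (ZFSet.pair (nm (g i)) (nm (h i)))

theorem mem_tripleGraph {ι : Type} {f g h : ι → ℕ} {x y z : ZFSet.{0}} :
    ZFSet.pair x (ZFSet.pair y z) ∈ tripleGraph f g h ↔
      ∃ i, x = nm (f i) ∧ y = nm (g i) ∧ z = nm (h i) := by
  rw [tripleGraph, ZFSet.mem_range]
  refine exists_congr fun i => ?_
  rw [ZFSet.pair_inj, ZFSet.pair_inj]
  tauto

theorem rank_pair_lt_of_isSuccLimit {α : Ordinal.{0}} (hα : Order.IsSuccLimit α) {x y : ZFSet.{0}}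
    (hx : x.rank < α) (hy : y.rank < α) : (ZFSet.pair x y).rank < α := by
  have := rank_pair_lt (Order.lt_succ_of_le (le_max_left x.rank y.rank))
    (Order.lt_succ_of_le (le_max_right x.rank y.rank))
  exact this.trans (hα.succ_lt (hα.succ_lt (hα.succ_lt (max_lt hx hy))))

theorem rank_tripleGraph_le {ι : Type} (f g h : ι → ℕ) :
    (tripleGraph f g h).rank ≤ Ordinal.omega0 := by
  refine ZFSet.rank_le_iff.2 fun x hx => ?_
  obtain ⟨i, rfl⟩ := ZFSet.mem_range.1 hx
  have hn : ∀ n, (nm n).rank < Ordinal.omega0 := fun n => by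
    rw [rank_nm]; exact Ordinal.natCast_lt_omega0 n
  have hω := Ordinal.isSuccLimit_omega0
  exact rank_pair_lt_of_isSuccLimit hω (hn _) (rank_pair_lt_of_isSuccLimit hω (hn _) (hn _))

/-- The code of a formula. -/
def Fm.code : Fm → ℕ
  | .mem i j => 4 * Nat.pair i j
  | .eq i j => 4 * Nat.pair i j + 1
  | .nand φ ψ => 4 * Nat.pair φ.code ψ.code + 2
  | .all i φ => 4 * Nat.pair i φ.code + 3

theorem Fm.code_injective : Function.Injective Fm.code := by
  intro φ
  induction φ with
  | mem i j =>
    intro χ h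
    cases χ with
    | mem k l => simpa [Fm.code, Nat.pair_eq_pair] using h
    | _ => simp only [Fm.code] at h; omega
  | eq i j =>
    intro χ h
    cases χ with
    | eq k l => simpa [Fm.code, Nat.pair_eq_pair] using h
    | _ => simp only [Fm.code] at h; omega
  | nand φ ψ ih1 ih2 =>
    intro χ h
    cases χ with
    | nand φ' ψ' =>
      simp only [Fm.code, Nat.add_right_cancel_iff, mul_eq_mul_left_iff, Nat.pair_eq_pair] at h
      rw [ih1 (h.resolve_right (by simp)).1, ih2 (h.resolve_right (by simp)).2]
    | _ => simp only [Fm.code] at h; omega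
  | all i φ ih =>
    intro χ h
    cases χ with
    | all k φ' =>
      simp only [Fm.code, Nat.add_right_cancel_iff, mul_eq_mul_left_iff, Nat.pair_eq_pair] at h
      rw [(h.resolve_right (by simp)).1, ih (h.resolve_right (by simp)).2]
    | _ => simp only [Fm.code] at h; omega

/-- The coded graph of the formation of membership formulas. -/
noncomputable def memGraph : ZFSet.{0} :=
  tripleGraph (fun p : ℕ × ℕ => (Fm.mem p.1 p.2).code) Prod.fst Prod.snd

/-- The coded graph of the formation of equations. -/
noncomputable def eqGraph : ZFSet.{0} :=
  tripleGraph (fun p : ℕ × ℕ => (Fm.eq p.1 p.2).code) Prod.fst Prod.snd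

/-- The coded graph of the formation of incompatibilities. -/
noncomputable def nandGraph : ZFSet.{0} :=
  tripleGraph (fun p : Fm × Fm => (Fm.nand p.1 p.2).code) (fun p => p.1.code) (fun p => p.2.code)

/-- The coded graph of the formation of universal formulas. -/
noncomputable def allGraph : ZFSet.{0} :=
  tripleGraph (fun p : ℕ × Fm => (Fm.all p.1 p.2).code) Prod.fst (fun p => p.2.code)

/-- The set `s` codes the assignment `w`. -/
def Codes (s : ZFSet.{0}) (w : ℕ → ZFSet.{0}) : Prop :=
  ∀ i u, ZFSet.pair (nm i) u ∈ s ↔ u = w i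

theorem Codes.unique {s : ZFSet.{0}} {w w' : ℕ → ZFSet.{0}} (h : Codes s w) (h' : Codes s w') :
    w = w' :=
  funext fun i => (h' i _).1 ((h i _).2 rfl)

/-- The canonical code of an assignment. -/
noncomputable def assignCode (w : ℕ → ZFSet.{0}) : ZFSet.{0} :=
  ZFSet.range fun i => ZFSet.pair (nm i) (w i)

theorem codes_assignCode (w : ℕ → ZFSet.{0}) : Codes (assignCode w) w := by
  intro i u
  rw [assignCode, ZFSet.mem_range]
  constructor
  · rintro ⟨j, hj⟩
    obtain ⟨h1, h2⟩ := ZFSet.pair_inj.1 hj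
    rw [← h2, nm_injective h1]
  · rintro rfl
    exact ⟨i, rfl⟩

theorem IsInaccOrd.exists_bound {κ : Ordinal.{0}} (h : IsInaccOrd κ) {ι : Type*}
    (hι : Cardinal.lift.{0} (Cardinal.mk ι) < Cardinal.lift κ.card) {f : ι → Ordinal.{0}}
    (hf : ∀ i, f i < κ) : ∃ σ < κ, ∀ i, f i ≤ σ := by
  refine ⟨⨆ i, f i, Ordinal.lift_iSup_lt_of_lt_cof ?_ hf, fun i => le_ciSup (f := f) ⟨κ, ?_⟩ i⟩
  · rw [← Ordinal.lift_cof, ← h.2, (Cardinal.isInaccessible_def.1 h.1).2.1.cof_ord]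
    exact hι
  · rintro _ ⟨i, rfl⟩
    exact (hf i).le

theorem IsInaccOrd.exists_bound_nat {κ : Ordinal.{0}} (h : IsInaccOrd κ) {f : ℕ → Ordinal.{0}}
    (hf : ∀ i, f i < κ) : ∃ σ < κ, ∀ i, f i ≤ σ :=
  h.exists_bound (by simpa using (Cardinal.isInaccessible_def.1 h.1).1) hf

theorem rank_assignCode_le {σ : Ordinal.{0}} (hσ : Ordinal.omega0 ≤ σ) {w : ℕ → ZFSet.{0}}
    (hw : ∀ i, (w i).rank < σ) : (assignCode w).rank ≤ Order.succ (Order.succ σ) := by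
  refine ZFSet.rank_le_iff.2 fun x hx => ?_
  obtain ⟨i, rfl⟩ := ZFSet.mem_range.1 hx
  refine rank_pair_lt ?_ (hw i)
  rw [rank_nm]
  exact (Ordinal.natCast_lt_omega0 i).trans_le hσ

/-! ### A truth definition for `Σ₃` formulas -/

namespace Fm

/-- The formula `(x_q, (x_i, x_j)) ∈ x_r`. -/
def tmem (q i j r : ℕ) : Fm :=
  ex (q + i + j + r + 1) (and (isPair (q + i + j + r + 1) i j) (pmem q (q + i + j + r + 1) r))

/-- The formula stating that `x_s` codes an assignment. -/
def isAssign (s : ℕ) : Fm :=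
  ball (s + 2) 1 (ex (s + 3) (all (s + 4) (iff (pmem (s + 2) (s + 4) s) (eq (s + 4) (s + 3)))))

/-- The formula stating that the assignments `x_s` and `x_t` agree on `x_d`. -/
def agreeOn (d s t : ℕ) : Fm :=
  ball (d + s + t + 1) d (all (d + s + t + 2)
    (iff (pmem (d + s + t + 1) (d + s + t + 2) s) (pmem (d + s + t + 1) (d + s + t + 2) t)))

/-- The formula stating that `x_t'` updates the assignment `x_t` at `x_i` to `x_x`. -/
def isUpdate (t i x t' : ℕ) : Fm :=
  ball (t + i + x + t' + 2) 1 (all (t + i + x + t' + 3)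
    (iff (pmem (t + i + x + t' + 2) (t + i + x + t' + 3) t')
      (or (and (eq (t + i + x + t' + 2) i) (eq (t + i + x + t' + 3) x))
        (and (neg (eq (t + i + x + t' + 2) i))
          (pmem (t + i + x + t' + 2) (t + i + x + t' + 3) t)))))

/-- The formula stating that `x₁₃` is a transitive set, that `x₁₄` is a set of assignments into
it closed under updates, and that `x₁₅` is a satisfaction relation for these assignments. -/
def isTruth : Fm :=
  and (isTrans 13) <|
  and (ball 16 14 (ball 17 1 (bex 18 13 (all 19 (iff (pmem 17 19 16) (eq 19 18)))))) <|
  and (ball 16 14 (ball 17 1 (ball 18 13 (bex 19 14 (isUpdate 16 17 18 19))))) <|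
  and (ball 16 14 (all 17 (all 18 (all 19 (imp (tmem 17 18 19 2) (iff (pmem 17 16 15)
    (ex 20 (ex 21 (and (pmem 18 20 16) (and (pmem 19 21 16) (mem 20 21)))))))))))  <|
  and (ball 16 14 (all 17 (all 18 (all 19 (imp (tmem 17 18 19 3) (iff (pmem 17 16 15)
    (ex 20 (and (pmem 18 20 16) (pmem 19 20 16)))))))))  <|
  and (ball 16 14 (all 17 (all 18 (all 19 (imp (tmem 17 18 19 4) (iff (pmem 17 16 15)
    (neg (and (pmem 18 16 15) (pmem 19 16 15))))))))) <|
  ball 16 14 (all 17 (all 18 (all 19 (imp (tmem 17 18 19 5) (iff (pmem 17 16 15)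
    (ball 20 13 (ball 21 14 (imp (isUpdate 16 18 20 21) (pmem 19 21 15)))))))))

/-- The formula stating that the formula coded by `x₆` holds of the assignment `x₁₂` in some
transitive set. -/
def holdsCoded : Fm :=
  ex 13 (ex 14 (ex 15 (and isTruth (and (mem 12 14) (pmem 6 12 15)))))

/-- The truth definition for `Σ₃` formulas: `x₆` codes the matrix, `x₇` and `x₈` the lengths of
the blocks, and `x₉` is the parameter. -/
def sigma3Truth : Fm :=
  ex 10 (and (isAssign 10) (and (pmem 0 9 10) (all 11 (imp (and (isAssign 11) (agreeOn 7 10 11))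
    (ex 12 (and (isAssign 12) (and (agreeOn 8 11 12) holdsCoded)))))))

end Fm

/-- The semantic counterpart of `Fm.isTruth`. -/
structure IsTruth {α : Ordinal.{0}} (N R₀ R₁ R₂ R₃ : ZFSet.{0}) (T A S : Vt α) : Prop where
  trans : T.1.IsTransitive
  assign : ∀ t : Vt α, t.1 ∈ A.1 → ∀ i : Vt α, i.1 ∈ N → ∃ u : Vt α, u.1 ∈ T.1 ∧
    ∀ u' : Vt α, ZFSet.pair i.1 u'.1 ∈ t.1 ↔ u' = u
  update : ∀ t : Vt α, t.1 ∈ A.1 → ∀ i : Vt α, i.1 ∈ N → ∀ x : Vt α, x.1 ∈ T.1 →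
    ∃ t' : Vt α, t'.1 ∈ A.1 ∧ ∀ j : Vt α, j.1 ∈ N → ∀ u : Vt α,
      ZFSet.pair j.1 u.1 ∈ t'.1 ↔ j = i ∧ u = x ∨ ¬ j = i ∧ ZFSet.pair j.1 u.1 ∈ t.1
  mem : ∀ t : Vt α, t.1 ∈ A.1 → ∀ q x y : Vt α, ZFSet.pair q.1 (ZFSet.pair x.1 y.1) ∈ R₀ →
    (ZFSet.pair q.1 t.1 ∈ S.1 ↔ ∃ u u' : Vt α,
      ZFSet.pair x.1 u.1 ∈ t.1 ∧ ZFSet.pair y.1 u'.1 ∈ t.1 ∧ u.1 ∈ u'.1)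
  eq : ∀ t : Vt α, t.1 ∈ A.1 → ∀ q x y : Vt α, ZFSet.pair q.1 (ZFSet.pair x.1 y.1) ∈ R₁ →
    (ZFSet.pair q.1 t.1 ∈ S.1 ↔ ∃ u : Vt α, ZFSet.pair x.1 u.1 ∈ t.1 ∧ ZFSet.pair y.1 u.1 ∈ t.1)
  nand : ∀ t : Vt α, t.1 ∈ A.1 → ∀ q x y : Vt α, ZFSet.pair q.1 (ZFSet.pair x.1 y.1) ∈ R₂ →
    (ZFSet.pair q.1 t.1 ∈ S.1 ↔ ¬ (ZFSet.pair x.1 t.1 ∈ S.1 ∧ ZFSet.pair y.1 t.1 ∈ S.1))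
  all : ∀ t : Vt α, t.1 ∈ A.1 → ∀ q i y : Vt α, ZFSet.pair q.1 (ZFSet.pair i.1 y.1) ∈ R₃ →
    (ZFSet.pair q.1 t.1 ∈ S.1 ↔ ∀ x : Vt α, x.1 ∈ T.1 → ∀ t' : Vt α, t'.1 ∈ A.1 →
      (∀ j : Vt α, j.1 ∈ N → ∀ u : Vt α,
        ZFSet.pair j.1 u.1 ∈ t'.1 ↔ j = i ∧ u = x ∨ ¬ j = i ∧ ZFSet.pair j.1 u.1 ∈ t.1) →
      ZFSet.pair y.1 t'.1 ∈ S.1)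

section TruthDefinition

variable {α : Ordinal.{0}}

theorem sat_tmem (hα : Order.IsSuccLimit α) {q i j r : ℕ} {v : ℕ → Vt α} :
    Sat Subtype.val (tmem q i j r) v ↔
      ZFSet.pair (v q).1 (ZFSet.pair (v i).1 (v j).1) ∈ (v r).1 := by
  have hc := pairClosed_Vt hα
  simp only [tmem, sat_ex, sat_and, hc.sat_isPair, hc.sat_pmem, Function.update_self,
    Function.update_of_ne (show q ≠ q + i + j + r + 1 by omega),
    Function.update_of_ne (show i ≠ q + i + j + r + 1 by omega),
    Function.update_of_ne (show j ≠ q + i + j + r + 1 by omega),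
    Function.update_of_ne (show r ≠ q + i + j + r + 1 by omega)]
  constructor
  · rintro ⟨x, hx, h⟩
    rwa [← hx]
  · intro h
    exact ⟨⟨_, rank_pair_lt_of_isSuccLimit hα (v i).2 (v j).2⟩, rfl, h⟩

theorem sat_isUpdate (hα : Order.IsSuccLimit α) {t i x t' : ℕ} {v : ℕ → Vt α} :
    Sat Subtype.val (isUpdate t i x t') v ↔ ∀ j : Vt α, j.1 ∈ (v 1).1 → ∀ u : Vt α,
      ZFSet.pair j.1 u.1 ∈ (v t').1 ↔
        j = v i ∧ u = v x ∨ ¬ j = v i ∧ ZFSet.pair j.1 u.1 ∈ (v t).1 := by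
  have hc := pairClosed_Vt hα
  simp only [isUpdate, sat_ball, sat_all, sat_iff, sat_or, sat_and, sat_neg, sat_eq, hc.sat_pmem,
    Function.update_self,
    Function.update_of_ne (show 1 ≠ t + i + x + t' + 2 by omega),
    Function.update_of_ne (show t ≠ t + i + x + t' + 2 by omega),
    Function.update_of_ne (show i ≠ t + i + x + t' + 2 by omega),
    Function.update_of_ne (show x ≠ t + i + x + t' + 2 by omega),
    Function.update_of_ne (show t' ≠ t + i + x + t' + 2 by omega),
    Function.update_of_ne (show t ≠ t + i + x + t' + 3 by omega),
    Function.update_of_ne (show i ≠ t + i + x + t' + 3 by omega),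
    Function.update_of_ne (show x ≠ t + i + x + t' + 3 by omega),
    Function.update_of_ne (show t' ≠ t + i + x + t' + 3 by omega),
    Function.update_of_ne (show t + i + x + t' + 2 ≠ t + i + x + t' + 3 by omega)]

theorem sat_isTruth (hα : Order.IsSuccLimit α) {v : ℕ → Vt α} :
    Sat Subtype.val isTruth v ↔
      IsTruth (v 1).1 (v 2).1 (v 3).1 (v 4).1 (v 5).1 (v 13) (v 14) (v 15) := by
  have hc := pairClosed_Vt hα
  simp only [isTruth, sat_and, sat_ball, sat_bex, sat_all, sat_ex, sat_imp, sat_iff, sat_neg,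
    sat_mem, sat_eq, sat_isUpdate hα, sat_tmem hα, hc.sat_pmem, hc.sat_isTrans]
  exact ⟨fun ⟨H1, H2, H3, H4, H5, H6, H7⟩ => ⟨H1, H2, H3, H4, H5, H6, H7⟩,
    fun ⟨H1, H2, H3, H4, H5, H6, H7⟩ => ⟨H1, H2, H3, H4, H5, H6, H7⟩⟩

end TruthDefinition

section TruthDefinition

variable {α : Ordinal.{0}}

theorem rank_snd_lt {x y t : ZFSet.{0}} (h : ZFSet.pair x y ∈ t) : y.rank < t.rank :=
  ((ZFSet.rank_lt_of_mem (ZFSet.mem_pair.2 (.inr rfl))).trans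
    (ZFSet.rank_lt_of_mem (ZFSet.mem_pair.2 (.inr rfl)))).trans (ZFSet.rank_lt_of_mem h)

theorem rank_nm_lt (hα : Ordinal.omega0 ≤ α) (n : ℕ) : (nm n).rank < α := by
  rw [rank_nm]
  exact (Ordinal.natCast_lt_omega0 n).trans_le hα

theorem exists_codes_iff (hα : Ordinal.omega0 ≤ α) {P : Vt α → Prop} {t : Vt α} :
    (∀ i : Vt α, i.1 ∈ nms → ∃ u : Vt α, P u ∧ ∀ u' : Vt α, ZFSet.pair i.1 u'.1 ∈ t.1 ↔ u' = u) ↔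
      ∃ w : ℕ → Vt α, (∀ i, P (w i)) ∧ Codes t.1 (fun i => (w i).1) := by
  constructor
  · intro H
    choose w hP hw using fun n : ℕ => H ⟨nm n, rank_nm_lt hα n⟩ (mem_nms.2 ⟨n, rfl⟩)
    refine ⟨w, hP, fun i u => ⟨fun hu => ?_, ?_⟩⟩
    · exact (congrArg Subtype.val ((hw i ⟨u, (rank_snd_lt hu).trans t.2⟩).1 hu) :)
    · rintro rfl
      exact (hw i _).2 rfl
  · rintro ⟨w, hP, hw⟩ ⟨i, hi⟩ hi'
    obtain ⟨n, rfl⟩ := mem_nms.1 hi'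
    exact ⟨w n, hP n, fun u' => (hw n u'.1).trans Subtype.ext_iff.symm⟩

theorem isUpdate_iff (hα : Ordinal.omega0 ≤ α) {t t' i x : Vt α} {w : ℕ → ZFSet.{0}}
    (hw : Codes t.1 w) {k : ℕ} (hi : i.1 = nm k) :
    (∀ j : Vt α, j.1 ∈ nms → ∀ u : Vt α,
      ZFSet.pair j.1 u.1 ∈ t'.1 ↔ j = i ∧ u = x ∨ ¬ j = i ∧ ZFSet.pair j.1 u.1 ∈ t.1) ↔
      Codes t'.1 (Function.update w k x.1) := by
  have key : ∀ (n : ℕ) (j u : Vt α), j.1 = nm n →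
      ((j = i ∧ u = x ∨ ¬ j = i ∧ ZFSet.pair j.1 u.1 ∈ t.1) ↔ u.1 = Function.update w k x.1 n) := by
    intro n j u hj
    rw [Subtype.ext_iff (a1 := j), hj, hi, nm_injective.eq_iff, hw n u.1, Subtype.ext_iff]
    by_cases hn : n = k
    · subst hn; simp
    · simp [hn]
  constructor
  · intro H n u
    have hn : nm n ∈ nms := mem_nms.2 ⟨n, rfl⟩
    constructor
    · intro hu
      have hu' := (rank_snd_lt hu).trans t'.2
      exact (key n ⟨nm n, rank_nm_lt hα n⟩ ⟨u, hu'⟩ rfl).1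
        ((H ⟨nm n, rank_nm_lt hα n⟩ hn ⟨u, hu'⟩).1 hu)
    · intro hu
      have hu' : u.rank < α := by
        rw [hu]
        by_cases hn : n = k
        · subst hn; simpa using x.2
        · rw [Function.update_of_ne hn]
          exact (rank_snd_lt ((hw n _).2 rfl)).trans t.2
      exact (H ⟨nm n, rank_nm_lt hα n⟩ hn ⟨u, hu'⟩).2
        ((key n ⟨nm n, rank_nm_lt hα n⟩ ⟨u, hu'⟩ rfl).2 hu)
  · intro H j hj u
    obtain ⟨n, hn⟩ := mem_nms.1 hj
    rw [key n j u hn.symm, ← hn]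
    exact H n u.1

theorem IsTruth.mem_iff_sat (hω : Ordinal.omega0 ≤ α) {T A S : Vt α}
    (H : IsTruth nms memGraph eqGraph nandGraph allGraph T A S) (φ : Fm) :
    ∀ (t : Vt α) (w : ℕ → {x // x ∈ T.1}), t.1 ∈ A.1 → Codes t.1 (fun i => (w i).1) →
      (ZFSet.pair (nm φ.code) t.1 ∈ S.1 ↔ Sat Subtype.val φ w) := by
  let n' : ℕ → Vt α := fun n => ⟨nm n, rank_nm_lt hω n⟩
  have hwα : ∀ x : {x // x ∈ T.1}, x.1.rank < α := fun x => (ZFSet.rank_lt_of_mem x.2).trans T.2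
  induction φ with
  | mem i j =>
    intro t w ht hw
    rw [H.mem t ht (n' _) (n' i) (n' j) (mem_tripleGraph.2 ⟨(i, j), rfl, rfl, rfl⟩)]
    simp only [n', hw _ _, sat_mem]
    constructor
    · rintro ⟨u, u', h1, h2, h3⟩
      rwa [← h1, ← h2]
    · intro h
      exact ⟨⟨_, hwα (w i)⟩, ⟨_, hwα (w j)⟩, rfl, rfl, h⟩
  | eq i j =>
    intro t w ht hw
    rw [H.eq t ht (n' _) (n' i) (n' j) (mem_tripleGraph.2 ⟨(i, j), rfl, rfl, rfl⟩)]
    simp only [n', hw _ _, sat_eq]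
    constructor
    · rintro ⟨u, h1, h2⟩
      exact Subtype.ext (h1.symm.trans h2)
    · intro h
      exact ⟨⟨_, hwα (w i)⟩, rfl, by rw [h]⟩
  | nand φ ψ ih1 ih2 =>
    intro t w ht hw
    rw [H.nand t ht (n' _) (n' φ.code) (n' ψ.code)
      (mem_tripleGraph.2 ⟨(φ, ψ), rfl, rfl, rfl⟩), ih1 t w ht hw, ih2 t w ht hw, sat_nand]
  | all k φ ih =>
    intro t w ht hw
    rw [H.all t ht (n' _) (n' k) (n' φ.code) (mem_tripleGraph.2 ⟨(k, φ), rfl, rfl, rfl⟩), sat_all]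
    have hupd : ∀ x : {x // x ∈ T.1}, Function.update (fun i => (w i).1) k x.1 =
        fun i => (Function.update w k x i).1 := fun x =>
      (Function.comp_update Subtype.val w k x).symm
    constructor
    · intro h x
      obtain ⟨t', ht', hu⟩ := H.update t ht (n' k) (mem_nms.2 ⟨k, rfl⟩) ⟨x.1, hwα x⟩ x.2
      refine (ih t' _ ht' ?_).1 (h ⟨x.1, hwα x⟩ x.2 t' ht' hu)
      rw [← hupd]
      exact (isUpdate_iff hω hw rfl).1 hu
    · intro h x hx t' ht' hu
      refine (ih t' (Function.update w k ⟨x.1, hx⟩) ht' ?_).2 (h ⟨x.1, hx⟩)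
      rw [← hupd]
      exact (isUpdate_iff hω hw rfl).1 hu

theorem exists_isTruth (hα : IsInaccOrd α) (w : ℕ → Vt α) :
    ∃ T A S : Vt α, IsTruth nms memGraph eqGraph nandGraph allGraph T A S ∧
      (∀ i, (w i).1 ∈ T.1) ∧ assignCode (fun i => (w i).1) ∈ A.1 := by
  have hlim := hα.isBethLimit.isSuccLimit
  have hω := hα.isBethLimit.omega_lt
  obtain ⟨σ, hσ, hωσ, hwσ⟩ : ∃ σ < α, Ordinal.omega0 ≤ σ ∧ ∀ i, (w i).1.rank < σ := by
    obtain ⟨σ, hσ, h⟩ := hα.exists_bound_nat fun i => (w i).2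
    exact ⟨max Ordinal.omega0 (Order.succ σ), max_lt hω (hlim.succ_lt hσ), le_max_left _ _,
      fun i => lt_max_of_lt_right (Order.lt_succ_of_le (h i))⟩
  let τ := Order.succ (Order.succ (Order.succ σ))
  have hτ : τ < α := hlim.succ_lt (hlim.succ_lt (hlim.succ_lt hσ))
  have hωτ : Ordinal.omega0 ≤ τ :=
    hωσ.trans ((Order.le_succ _).trans ((Order.le_succ _).trans (Order.le_succ _)))
  let T : ZFSet.{0} := ZFSet.vonNeumann σ
  let enc : (ℕ → {x // x ∈ T}) → ZFSet.{0} := fun w => assignCode fun i => (w i).1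
  have henc : ∀ w, Codes (enc w) fun i => (w i).1 := fun w => codes_assignCode _
  have hencr : ∀ w, (enc w).rank < τ := fun w =>
    Order.lt_succ_of_le (rank_assignCode_le hωσ fun i => ZFSet.mem_vonNeumann.1 (w i).2)
  have encinj : ∀ w w', enc w = enc w' → w = w' := fun w w' h => by
    have := (henc w).unique (h ▸ henc w')
    exact funext fun i => Subtype.ext (congrFun this i)
  let A : ZFSet.{0} := (ZFSet.vonNeumann τ).sep fun t => ∃ w, enc w = t
  have hA : ∀ t, t ∈ A ↔ ∃ w, enc w = t := fun t => by
    rw [ZFSet.mem_sep, ZFSet.mem_vonNeumann]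
    refine ⟨And.right, ?_⟩
    rintro ⟨w, rfl⟩
    exact ⟨hencr w, w, rfl⟩
  let S : ZFSet.{0} := (ZFSet.vonNeumann (Order.succ (Order.succ τ))).sep fun z =>
    ∃ (φ : Fm) (w : _), z = ZFSet.pair (nm φ.code) (enc w) ∧ Sat Subtype.val φ w
  have hS : ∀ φ w, ZFSet.pair (nm φ.code) (enc w) ∈ S ↔ Sat Subtype.val φ w := by
    intro φ w
    rw [ZFSet.mem_sep, ZFSet.mem_vonNeumann]
    constructor
    · rintro ⟨-, φ', w', h, hs⟩
      obtain ⟨h1, h2⟩ := ZFSet.pair_inj.1 h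
      rwa [Fm.code_injective (nm_injective h1), encinj _ _ h2]
    · intro hs
      exact ⟨rank_pair_lt (rank_nm_lt hωτ _) (hencr w), φ, w, rfl, hs⟩
  have hTα : T.rank < α := by rwa [ZFSet.rank_vonNeumann]
  have hupd : ∀ (w : ℕ → {x // x ∈ T}) k x, Function.update (fun i => (w i).1) k x.1 =
      fun i => (Function.update w k x i).1 := fun w k x =>
    (Function.comp_update Subtype.val w k x).symm
  have hTr : ∀ x : {x // x ∈ T}, x.1.rank < α := fun x => (ZFSet.rank_lt_of_mem x.2).trans hTα
  refine ⟨⟨T, hTα⟩, ⟨A, ?_⟩, ⟨S, ?_⟩, ?_, fun i => ZFSet.mem_vonNeumann.2 (hwσ i),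
    (hA _).2 ⟨fun i => ⟨(w i).1, ZFSet.mem_vonNeumann.2 (hwσ i)⟩, rfl⟩⟩
  · refine lt_of_le_of_lt (ZFSet.rank_mono (ZFSet.sep_subset)) ?_
    rwa [ZFSet.rank_vonNeumann]
  · refine lt_of_le_of_lt (ZFSet.rank_mono (ZFSet.sep_subset)) ?_
    rw [ZFSet.rank_vonNeumann]
    exact hlim.succ_lt (hlim.succ_lt hτ)
  constructor
  · exact ZFSet.isTransitive_vonNeumann σ
  · rintro ⟨t, ht⟩ htA
    obtain ⟨w, rfl⟩ := (hA t).1 htA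
    exact (exists_codes_iff hω.le).2 ⟨fun i => ⟨(w i).1, hTr _⟩, fun i => (w i).2, henc w⟩
  · rintro ⟨t, ht⟩ htA ⟨i, hi'⟩ hi x hx
    obtain ⟨w, rfl⟩ := (hA t).1 htA
    obtain ⟨k, rfl⟩ := mem_nms.1 hi
    refine ⟨⟨enc (Function.update w k ⟨x.1, hx⟩), (hencr _).trans hτ⟩, (hA _).2 ⟨_, rfl⟩, ?_⟩
    refine (isUpdate_iff hω.le (henc w) rfl).2 ?_
    exact hupd w k ⟨x.1, hx⟩ ▸ henc _
  · rintro ⟨t, ht⟩ htA ⟨q, hq⟩ ⟨x, hx⟩ ⟨y, hy⟩ hR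
    obtain ⟨w, rfl⟩ := (hA t).1 htA
    obtain ⟨⟨i, j⟩, rfl, rfl, rfl⟩ := mem_tripleGraph.1 hR
    simp only [hS, henc w _ _, sat_mem]
    constructor
    · intro h
      exact ⟨⟨_, hTr (w i)⟩, ⟨_, hTr (w j)⟩, rfl, rfl, h⟩
    · rintro ⟨u, u', h1, h2, h3⟩
      rwa [← h1, ← h2]
  · rintro ⟨t, ht⟩ htA ⟨q, hq⟩ ⟨x, hx⟩ ⟨y, hy⟩ hR
    obtain ⟨w, rfl⟩ := (hA t).1 htA
    obtain ⟨⟨i, j⟩, rfl, rfl, rfl⟩ := mem_tripleGraph.1 hR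
    simp only [hS, henc w _ _, sat_eq]
    constructor
    · intro h
      exact ⟨⟨_, hTr (w i)⟩, rfl, by rw [h]⟩
    · rintro ⟨u, h1, h2⟩
      exact Subtype.ext (h1.symm.trans h2)
  · rintro ⟨t, ht⟩ htA ⟨q, hq⟩ ⟨x, hx⟩ ⟨y, hy⟩ hR
    obtain ⟨w, rfl⟩ := (hA t).1 htA
    obtain ⟨⟨φ, ψ⟩, rfl, rfl, rfl⟩ := mem_tripleGraph.1 hR
    simp only [hS, sat_nand]
  · rintro ⟨t, ht⟩ htA ⟨q, hq⟩ ⟨i, hi⟩ ⟨y, hy⟩ hR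
    obtain ⟨w, rfl⟩ := (hA t).1 htA
    obtain ⟨⟨k, φ⟩, rfl, rfl, rfl⟩ := mem_tripleGraph.1 hR
    simp only [hS, sat_all]
    constructor
    · rintro h x hx ⟨t', ht'⟩ htA' hu
      obtain ⟨w', rfl⟩ := (hA t').1 htA'
      have h1 := (isUpdate_iff (t := ⟨enc w, ht⟩) (t' := ⟨enc w', ht'⟩) (i := ⟨nm k, hi⟩)
        hω.le (henc w) rfl).1 hu
      rw [hupd w k ⟨x.1, hx⟩] at h1
      have h2 : w' = Function.update w k ⟨x.1, hx⟩ :=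
        funext fun i => Subtype.ext (congrFun ((henc w').unique h1) i)
      simp only [hS, h2]
      exact h _
    · intro h x
      refine (hS _ _).1 (h ⟨x.1, hTr x⟩ x.2 ⟨enc (Function.update w k x), (hencr _).trans hτ⟩
        ((hA _).2 ⟨_, rfl⟩) ?_)
      refine (isUpdate_iff (t := ⟨enc w, ht⟩) (t' := ⟨enc (Function.update w k x), _⟩)
        (i := ⟨nm k, hi⟩) (x := ⟨x.1, hTr x⟩) hω.le (henc w) rfl).2 ?_
      exact hupd w k x ▸ henc _

end TruthDefinition

section TruthDefinition

variable {α : Ordinal.{0}}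

theorem sat_isAssign (hα : Order.IsSuccLimit α) (hω : Ordinal.omega0 ≤ α) {s : ℕ} (hs : 1 ≤ s)
    {v : ℕ → Vt α} (h1 : (v 1).1 = nms) :
    Sat Subtype.val (isAssign s) v ↔ ∃ w : ℕ → Vt α, Codes (v s).1 (fun i => (w i).1) := by
  have hc := pairClosed_Vt hα
  have := exists_codes_iff hω (P := fun _ => True) (t := v s)
  simp only [true_and, implies_true] at this
  rw [← this, ← h1]
  simp only [isAssign, sat_ball, sat_ex, sat_all, sat_iff, hc.sat_pmem, sat_eq,
    Function.update_self,
    Function.update_of_ne (show 1 ≠ s + 2 by omega),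
    Function.update_of_ne (show s ≠ s + 2 by omega),
    Function.update_of_ne (show s ≠ s + 3 by omega),
    Function.update_of_ne (show s ≠ s + 4 by omega),
    Function.update_of_ne (show s + 2 ≠ s + 3 by omega),
    Function.update_of_ne (show s + 2 ≠ s + 4 by omega),
    Function.update_of_ne (show s + 3 ≠ s + 4 by omega)]

theorem sat_agreeOn (hα : Order.IsSuccLimit α) (hω : Ordinal.omega0 ≤ α) {d s t p : ℕ}
    {v : ℕ → Vt α} (hd : (v d).1 = nmsLe p) {w w' : ℕ → Vt α}
    (hw : Codes (v s).1 (fun i => (w i).1)) (hw' : Codes (v t).1 (fun i => (w' i).1)) :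
    Sat Subtype.val (agreeOn d s t) v ↔ Agree p w' w := by
  have hc := pairClosed_Vt hα
  simp only [agreeOn, sat_ball, sat_all, sat_iff, hc.sat_pmem, Function.update_self,
    Function.update_of_ne (show d ≠ d + s + t + 1 by omega),
    Function.update_of_ne (show s ≠ d + s + t + 1 by omega),
    Function.update_of_ne (show t ≠ d + s + t + 1 by omega),
    Function.update_of_ne (show s ≠ d + s + t + 2 by omega),
    Function.update_of_ne (show t ≠ d + s + t + 2 by omega),
    Function.update_of_ne (show d + s + t + 1 ≠ d + s + t + 2 by omega), hd]
  constructor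
  · intro H i hi
    have := (H ⟨nm i, rank_nm_lt hω i⟩ (nm_mem_nmsLe.2 hi) (w i)).1 ((hw i _).2 rfl)
    exact Subtype.ext ((hw' i _).1 this).symm
  · rintro H ⟨i, hi⟩ hip u
    obtain ⟨n, rfl⟩ := mem_nms.1 (nmsLe_subset p hip)
    have hn : w' n = w n := H n (nm_mem_nmsLe.1 hip)
    rw [hw n, hw' n]
    simp only [hn]

/-- The variables with fixed meanings in `Fm.sigma3Truth` are interpreted correctly. -/
structure IsTruthEnv (c p q : ℕ) (v : ℕ → Vt α) : Prop where
  zero : (v 0).1 = nm 0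
  nms : (v 1).1 = nms
  mem : (v 2).1 = memGraph
  eq : (v 3).1 = eqGraph
  nand : (v 4).1 = nandGraph
  all : (v 5).1 = allGraph
  code : (v 6).1 = nm c
  fst : (v 7).1 = nmsLe p
  snd : (v 8).1 = nmsLe q

theorem IsTruthEnv.update {c p q : ℕ} {v : ℕ → Vt α} (h : IsTruthEnv c p q v) {k : ℕ}
    (hk : 9 ≤ k) (x : Vt α) : IsTruthEnv c p q (Function.update v k x) := by
  have H : ∀ i < 9, Function.update v k x i = v i := fun i hi =>
    Function.update_of_ne (by omega) _ _
  constructor <;> rw [H _ (by norm_num)]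
  exacts [h.zero, h.nms, h.mem, h.eq, h.nand, h.all, h.code, h.fst, h.snd]

theorem sat_holdsCoded (hα : Order.IsSuccLimit α) {c p q : ℕ} {v : ℕ → Vt α}
    (hv : IsTruthEnv c p q v) :
    Sat Subtype.val holdsCoded v ↔ ∃ T A S : Vt α,
      IsTruth nms memGraph eqGraph nandGraph allGraph T A S ∧ (v 12).1 ∈ A.1 ∧
        ZFSet.pair (nm c) (v 12).1 ∈ S.1 := by
  simp only [holdsCoded, sat_ex, sat_and, sat_isTruth hα, sat_mem, (pairClosed_Vt hα).sat_pmem]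
  rw [← hv.nms, ← hv.mem, ← hv.eq, ← hv.nand, ← hv.all, ← hv.code]
  exact Iff.rfl

theorem Fm.Absolute.sat_iff {δ : Fm} (hδ : δ.Absolute) {T : ZFSet.{0}} (hT : T.IsTransitive)
    {w : ℕ → Vt α} (hw : ∀ i, (w i).1 ∈ T) :
    Sat Subtype.val δ (fun i => (⟨(w i).1, hw i⟩ : {x // x ∈ T})) ↔ Sat Subtype.val δ w := by
  rw [hδ Subtype.val Subtype.val_injective fun x z hz => ⟨⟨z, hT.mem_trans hz x.2⟩, rfl⟩,
    hδ (Subtype.val : Vt α → ZFSet.{0}) Subtype.val_injective fun x z hz =>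
      ⟨⟨z, (ZFSet.rank_lt_of_mem hz).trans x.2⟩, rfl⟩]
  exact Iff.rfl

theorem sat_of_sat_holdsCoded (hα : Order.IsSuccLimit α) (hω : Ordinal.omega0 ≤ α) {δ : Fm}
    (hδ : δ.Absolute) {p q : ℕ} {v : ℕ → Vt α} (hv : IsTruthEnv δ.code p q v) {w : ℕ → Vt α}
    (hw : Codes (v 12).1 (fun i => (w i).1)) (h : Sat Subtype.val holdsCoded v) :
    Sat Subtype.val δ w := by
  obtain ⟨T, A, S, H, hA, hS⟩ := (sat_holdsCoded hα hv).1 h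
  obtain ⟨u, hu, hu'⟩ := (exists_codes_iff hω).1 (H.assign (v 12) hA)
  obtain rfl : u = w := funext fun i => Subtype.ext (congrFun (hu'.unique hw) i)
  exact (hδ.sat_iff H.trans hu).1
    ((H.mem_iff_sat hω δ (v 12) (fun i => ⟨(u i).1, hu i⟩) hA hw).1 hS)

theorem sat_holdsCoded_of_sat (hα : IsInaccOrd α) {δ : Fm} (hδ : δ.Absolute) {p q : ℕ}
    {v : ℕ → Vt α} (hv : IsTruthEnv δ.code p q v) {w : ℕ → Vt α}
    (hw : (v 12).1 = assignCode (fun i => (w i).1)) (h : Sat Subtype.val δ w) :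
    Sat Subtype.val holdsCoded v := by
  obtain ⟨T, A, S, H, hT, hA⟩ := exists_isTruth hα w
  rw [← hw] at hA
  have hu : Codes (v 12).1 (fun i => (w i).1) := hw ▸ codes_assignCode _
  exact (sat_holdsCoded hα.isBethLimit.isSuccLimit hv).2 ⟨T, A, S, H, hA,
    (H.mem_iff_sat hα.isBethLimit.omega_lt.le δ (v 12) (fun i => ⟨(w i).1, hT i⟩) hA hu).2
      ((hδ.sat_iff H.trans hT).2 h)⟩

theorem exists_val_eq_assignCode (hα : IsInaccOrd α) (w : ℕ → Vt α) :
    ∃ s : Vt α, s.1 = assignCode fun i => (w i).1 := by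
  have hlim := hα.isBethLimit.isSuccLimit
  obtain ⟨σ, hσ, h⟩ := hα.exists_bound_nat fun i => (w i).2
  refine ⟨⟨_, (rank_assignCode_le (le_max_left Ordinal.omega0 (Order.succ σ)) fun i =>
    lt_max_of_lt_right (Order.lt_succ_of_le (h i))).trans_lt ?_⟩, rfl⟩
  exact hlim.succ_lt (hlim.succ_lt (max_lt hα.isBethLimit.omega_lt (hlim.succ_lt hσ)))

theorem sat_sigma3Truth (hα : IsInaccOrd α) {δ : Fm} (hδ : δ.Absolute) {p q : ℕ} {v : ℕ → Vt α}
    (hv : IsTruthEnv δ.code p q v) :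
    Sat Subtype.val sigma3Truth v ↔ ∃ w₁ : ℕ → Vt α, w₁ 0 = v 9 ∧
      ∀ w₂, Agree p w₂ w₁ → ∃ w₃, Agree q w₃ w₂ ∧ Sat Subtype.val δ w₃ := by
  have hlim := hα.isBethLimit.isSuccLimit
  have hω := hα.isBethLimit.omega_lt.le
  simp only [sigma3Truth, sat_ex, sat_and, sat_all, sat_imp]
  constructor
  · rintro ⟨s₁, ha₁, h0, H⟩
    have hv₁ := hv.update (k := 10) (by norm_num) s₁
    obtain ⟨w₁, hw₁⟩ := (sat_isAssign hlim hω (by norm_num) hv₁.nms).1 ha₁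
    refine ⟨w₁, ?_, fun w₂ h₂ => ?_⟩
    · rw [(pairClosed_Vt hlim).sat_pmem, hv₁.zero] at h0
      exact Subtype.ext ((hw₁ 0 _).1 h0).symm
    · obtain ⟨s₂, hs₂⟩ := exists_val_eq_assignCode hα w₂
      have hw₂ : Codes s₂.1 (fun i => (w₂ i).1) := hs₂ ▸ codes_assignCode _
      have hv₂ := hv₁.update (k := 11) (by norm_num) s₂
      obtain ⟨s₃, ha₃, h₃, h⟩ := H s₂ ⟨(sat_isAssign hlim hω (by norm_num) hv₂.nms).2 ⟨w₂, hw₂⟩,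
        (sat_agreeOn (s := 10) (t := 11) hlim hω hv₂.fst hw₁ hw₂).2 h₂⟩
      have hv₃ := hv₂.update (k := 12) (by norm_num) s₃
      obtain ⟨w₃, hw₃⟩ := (sat_isAssign hlim hω (by norm_num) hv₃.nms).1 ha₃
      exact ⟨w₃, (sat_agreeOn (s := 11) (t := 12) hlim hω hv₃.snd hw₂ hw₃).1 h₃,
        sat_of_sat_holdsCoded hlim hω hδ hv₃ hw₃ h⟩
  · rintro ⟨w₁, h0, H⟩
    obtain ⟨s₁, hs₁⟩ := exists_val_eq_assignCode hα w₁
    have hw₁ : Codes s₁.1 (fun i => (w₁ i).1) := hs₁ ▸ codes_assignCode _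
    have hv₁ := hv.update (k := 10) (by norm_num) s₁
    refine ⟨s₁, (sat_isAssign hlim hω (by norm_num) hv₁.nms).2 ⟨w₁, hw₁⟩, ?_, ?_⟩
    · rw [(pairClosed_Vt hlim).sat_pmem, hv₁.zero]
      exact (hw₁ 0 _).2 (congrArg Subtype.val h0.symm)
    · rintro s₂ ⟨ha₂, hag₂⟩
      have hv₂ := hv₁.update (k := 11) (by norm_num) s₂
      obtain ⟨w₂, hw₂⟩ := (sat_isAssign hlim hω (by norm_num) hv₂.nms).1 ha₂
      obtain ⟨w₃, h₃, h⟩ := H w₂ ((sat_agreeOn (s := 10) (t := 11) hlim hω hv₂.fst hw₁ hw₂).1 hag₂)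
      obtain ⟨s₃, hs₃⟩ := exists_val_eq_assignCode hα w₃
      have hw₃ : Codes s₃.1 (fun i => (w₃ i).1) := hs₃ ▸ codes_assignCode _
      have hv₃ := hv₂.update (k := 12) (by norm_num) s₃
      exact ⟨s₃, (sat_isAssign hlim hω (by norm_num) hv₃.nms).2 ⟨w₃, hw₃⟩,
        (sat_agreeOn (s := 11) (t := 12) hlim hω hv₃.snd hw₂ hw₃).2 h₃,
        sat_holdsCoded_of_sat hα hδ hv₃ hs₃ h⟩

theorem varsLt_sigma3Truth : varsLt 1000 sigma3Truth = true := by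
  decide

end TruthDefinition

/-! ### Levels of the hierarchy with inaccessible height -/

/-- First-order conditions in `V_α` on a set `B`, stating that `B` is a level of the cumulative
hierarchy whose height is strongly inaccessible. -/
structure IsInaccLevel {α : Ordinal.{0}} (B : Vt α) : Prop where
  trans : B.1.IsTransitive
  subset : ∀ x : Vt α, x.1 ∈ B.1 → ∀ y : Vt α, y.1 ⊆ x.1 → y.1 ∈ B.1
  power : ∀ x : Vt α, x.1 ∈ B.1 → ∃ y : Vt α, y.1 ∈ B.1 ∧ ∀ z : Vt α, z.1 ⊆ x.1 → z.1 ∈ y.1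
  replacement : ∀ x : Vt α, x.1 ∈ B.1 → ∀ f : Vt α,
    (∀ u : Vt α, u.1 ∈ x.1 → ∃ z : Vt α, z.1 ∈ B.1 ∧
      ∀ z' : Vt α, ZFSet.pair u.1 z'.1 ∈ f.1 ↔ z' = z) →
    ∃ y : Vt α, y.1 ∈ B.1 ∧ ∀ u : Vt α, u.1 ∈ x.1 → ∀ z : Vt α, ZFSet.pair u.1 z.1 ∈ f.1 →
      z.1 ⊆ y.1

/-- The formula expressing `IsInaccLevel` of `x₁₀₀₀`. -/
def Fm.isInaccLevel : Fm :=
  and (isTrans 1000) <|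
  and (ball 1001 1000 (all 1002 (imp (isSub 1002 1001) (mem 1002 1000)))) <|
  and (ball 1001 1000 (bex 1002 1000 (all 1003 (imp (isSub 1003 1001) (mem 1003 1002))))) <|
  ball 1001 1000 (all 1002 (imp
    (ball 1003 1001 (bex 1004 1000 (all 1005 (iff (pmem 1003 1005 1002) (eq 1005 1004)))))
    (bex 1003 1000 (ball 1004 1001 (all 1005 (imp (pmem 1004 1005 1002) (isSub 1005 1003)))))))

theorem sat_isInaccLevel {α : Ordinal.{0}} (hα : Order.IsSuccLimit α) {v : ℕ → Vt α} :
    Sat Subtype.val isInaccLevel v ↔ IsInaccLevel (v 1000) := by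
  have hc := pairClosed_Vt hα
  simp only [isInaccLevel, sat_and, sat_ball, sat_bex, sat_all, sat_imp, sat_iff,
    sat_mem, sat_eq, hc.sat_pmem, hc.sat_isTrans, hc.sat_isSub]
  exact ⟨fun ⟨H1, H2, H3, H4⟩ => ⟨H1, H2, H3, H4⟩, fun ⟨H1, H2, H3, H4⟩ => ⟨H1, H2, H3, H4⟩⟩

theorem IsInaccOrd.isInaccLevel {κ γ : Ordinal.{0}} (h : IsInaccOrd κ) (hκγ : κ < γ) {B : Vt γ}
    (hB : B.1 = ZFSet.vonNeumann κ) : IsInaccLevel B := by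
  have hlim := h.isBethLimit.isSuccLimit
  constructor
  all_goals simp only [hB, ZFSet.mem_vonNeumann]
  · exact ZFSet.isTransitive_vonNeumann κ
  · exact fun x hx y hy => (ZFSet.rank_mono hy).trans_lt hx
  · intro x hx
    refine ⟨⟨ZFSet.powerset x.1, ?_⟩, ?_, fun z hz => ZFSet.mem_powerset.2 hz⟩
    all_goals rw [ZFSet.rank_powerset]
    exacts [(hlim.succ_lt hx).trans hκγ, hlim.succ_lt hx]
  · intro x hx f hf
    choose g hg hgf using fun u : x.1 => hf ⟨u.1, (ZFSet.rank_lt_of_mem u.2).trans x.2⟩ u.2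
    obtain ⟨σ, hσ, hgσ⟩ := h.exists_bound (ι := x.1) (f := fun u => (g u).1.rank) (by
      rw [Cardinal.lift_uzero, ZFSet.cardinalMk_coe_sort]
      refine Cardinal.lift_lt.2 (lt_of_le_of_lt ?_ (h.isBethLimit.card_lt _ hx))
      exact ZFSet.card_mono (ZFSet.subset_vonNeumann.2 le_rfl)) hg
    refine ⟨⟨ZFSet.vonNeumann σ, ?_⟩, ?_, fun u hu z hz => ?_⟩
    · rw [ZFSet.rank_vonNeumann]; exact hσ.trans hκγ
    · rwa [ZFSet.rank_vonNeumann]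
    · rw [(hgf ⟨u.1, hu⟩ z).1 hz, ZFSet.subset_vonNeumann]
      exact hgσ _

namespace IsInaccLevel

variable {α : Ordinal.{0}} {B : Vt α}

theorem mem_of_subset (hB : IsInaccLevel B) {x y : ZFSet.{0}} (hx : x ∈ B.1) (hy : y ⊆ x) :
    y ∈ B.1 :=
  have hxα := (ZFSet.rank_lt_of_mem hx).trans B.2
  hB.subset ⟨x, hxα⟩ hx ⟨y, (ZFSet.rank_mono hy).trans_lt hxα⟩ hy

theorem exists_power (hB : IsInaccLevel B) {x : ZFSet.{0}} (hx : x ∈ B.1) :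
    ∃ y ∈ B.1, ∀ z ⊆ x, z ∈ y := by
  have hxα := (ZFSet.rank_lt_of_mem hx).trans B.2
  obtain ⟨y, hy, H⟩ := hB.power ⟨x, hxα⟩ hx
  exact ⟨y.1, hy, fun z hz => H ⟨z, (ZFSet.rank_mono hz).trans_lt hxα⟩ hz⟩

theorem exists_replacement (hB : IsInaccLevel B) (hα : Order.IsSuccLimit α) {x : ZFSet.{0}}
    (hx : x ∈ B.1) {g : ZFSet.{0} → ZFSet.{0}} (hg : ∀ u ∈ x, g u ∈ B.1) :
    ∃ y ∈ B.1, ∀ u ∈ x, g u ⊆ y := by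
  have hBα : ∀ {z}, z ∈ B.1 → z.rank < α := fun hz => (ZFSet.rank_lt_of_mem hz).trans B.2
  have hxB : ∀ {u}, u ∈ x → u ∈ B.1 := fun hu => hB.trans.mem_trans hu hx
  let f : ZFSet.{0} := (ZFSet.vonNeumann (Order.succ (Order.succ B.1.rank))).sep
    fun z => ∃ u ∈ x, z = ZFSet.pair u (g u)
  have hf : ∀ {u}, u ∈ x → ∀ z, ZFSet.pair u z ∈ f ↔ z = g u := by
    intro u hu z
    rw [ZFSet.mem_sep, ZFSet.mem_vonNeumann]
    constructor
    · rintro ⟨-, u', -, h⟩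
      obtain ⟨rfl, rfl⟩ := ZFSet.pair_inj.1 h
      rfl
    · rintro rfl
      exact ⟨rank_pair_lt (ZFSet.rank_lt_of_mem (hxB hu)) (ZFSet.rank_lt_of_mem (hg u hu)),
        u, hu, rfl⟩
  have hfα : f.rank < α := by
    refine (ZFSet.rank_mono ZFSet.sep_subset).trans_lt ?_
    rw [ZFSet.rank_vonNeumann]
    exact hα.succ_lt (hα.succ_lt B.2)
  obtain ⟨y, hy, H⟩ := hB.replacement ⟨x, hBα hx⟩ hx ⟨f, hfα⟩ fun u hu =>
    ⟨⟨g u.1, hBα (hg _ hu)⟩, hg _ hu, fun z => by rw [Subtype.ext_iff]; exact hf hu z.1⟩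
  exact ⟨y.1, hy, fun u hu => H ⟨u, hBα (hxB hu)⟩ hu ⟨g u, hBα (hg u hu)⟩ ((hf hu _).2 rfl)⟩

theorem vonNeumann_rank_mem (hB : IsInaccLevel B) (hα : Order.IsSuccLimit α) (x : ZFSet.{0}) :
    x ∈ B.1 → ZFSet.vonNeumann x.rank ∈ B.1 := by
  induction x using ZFSet.inductionOn with
  | _ x ih =>
    intro hx
    obtain ⟨y, hy, H⟩ := hB.exists_replacement hα hx (g := fun u => ZFSet.vonNeumann u.rank)
      fun u hu => ih u hu (hB.trans.mem_trans hu hx)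
    obtain ⟨y', hy', H'⟩ := hB.exists_power hy
    refine hB.mem_of_subset hy' fun z hz => H' z fun t ht => ?_
    obtain ⟨u, hu, hzu⟩ := ZFSet.lt_rank_iff.1 (ZFSet.mem_vonNeumann.1 hz)
    exact H u hu (ZFSet.mem_vonNeumann.2 ((ZFSet.rank_lt_of_mem ht).trans_le hzu))

theorem mem_iff (hB : IsInaccLevel B) (hα : Order.IsSuccLimit α) {z : ZFSet.{0}} :
    z ∈ B.1 ↔ z.rank < B.1.rank := by
  refine ⟨ZFSet.rank_lt_of_mem, fun hz => ?_⟩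
  obtain ⟨x, hx, hzx⟩ := ZFSet.lt_rank_iff.1 hz
  exact hB.mem_of_subset (hB.vonNeumann_rank_mem hα x hx) (ZFSet.subset_vonNeumann.2 hzx)

theorem vonNeumann_mem (hB : IsInaccLevel B) (hα : Order.IsSuccLimit α) {o : Ordinal.{0}}
    (ho : o < B.1.rank) : ZFSet.vonNeumann o ∈ B.1 := by
  rwa [hB.mem_iff hα, ZFSet.rank_vonNeumann]

theorem succ_lt (hB : IsInaccLevel B) (hα : Order.IsSuccLimit α) {o : Ordinal.{0}}
    (ho : o < B.1.rank) : Order.succ o < B.1.rank := by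
  obtain ⟨y, hy, H⟩ := hB.exists_power (hB.vonNeumann_mem hα ho)
  refine lt_of_le_of_lt (Order.succ_le_of_lt ?_) (ZFSet.rank_lt_of_mem hy)
  simpa using ZFSet.rank_lt_of_mem (H (ZFSet.vonNeumann o) fun _ h => h)

theorem exists_bound (hB : IsInaccLevel B) (hα : Order.IsSuccLimit α) {o : Ordinal.{0}}
    (ho : o < B.1.rank) {s : Set (Set.Iio B.1.rank)}
    (hs : Cardinal.mk s ≤ Cardinal.lift.{1} (ZFSet.vonNeumann o).card) :
    ∃ σ < B.1.rank, ∀ a ∈ s, a.1 < σ := by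
  classical
  rw [← ZFSet.cardinalMk_coe_sort] at hs
  obtain ⟨e⟩ := hs
  rcases isEmpty_or_nonempty s with hs | hs
  · exact ⟨o, ho, fun a ha => (hs.false ⟨a, ha⟩).elim⟩
  let r : ZFSet.{0} → Ordinal.{0} := fun u =>
    if h : u ∈ ZFSet.vonNeumann o then (Function.invFun e ⟨u, h⟩).1.1 else 0
  have hr : ∀ u ∈ ZFSet.vonNeumann o, r u < B.1.rank := fun u hu => by
    simp only [r, hu, dif_pos]
    exact (Function.invFun e ⟨u, hu⟩).1.2
  obtain ⟨y, hy, H⟩ := hB.exists_replacement hα (hB.vonNeumann_mem hα ho)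
    (g := fun u => ZFSet.vonNeumann (r u)) fun u hu => hB.vonNeumann_mem hα (hr u hu)
  refine ⟨Order.succ y.rank, hB.succ_lt hα (ZFSet.rank_lt_of_mem hy), fun a ha => ?_⟩
  have h1 : r (e ⟨a, ha⟩).1 = a.1 := by
    have : (e ⟨a, ha⟩).1 ∈ ZFSet.vonNeumann o := (e ⟨a, ha⟩).2
    simp only [r, this, dif_pos]
    exact congrArg (fun z : s => z.1.1) (Function.leftInverse_invFun e.injective ⟨a, ha⟩)
  have h2 := ZFSet.rank_mono (H _ (e ⟨a, ha⟩).2)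
  rw [ZFSet.rank_vonNeumann, h1] at h2
  exact Order.lt_succ_of_le h2

theorem card_vonNeumann_lt (hB : IsInaccLevel B) (hα : Order.IsSuccLimit α) {o : Ordinal.{0}}
    (ho : o < B.1.rank) : (ZFSet.vonNeumann o).card < B.1.rank.card := by
  by_contra! h
  obtain ⟨σ, hσ, H⟩ := hB.exists_bound hα ho (s := Set.univ) (by
    rw [Cardinal.mk_univ, Cardinal.mk_Iio_ordinal]
    exact Cardinal.lift_le.2 h)
  exact lt_irrefl _ (H ⟨σ, hσ⟩ trivial)

theorem isInaccOrd (hB : IsInaccLevel B) (hα : Order.IsSuccLimit α)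
    (hω : Ordinal.omega0 < B.1.rank) : IsInaccOrd B.1.rank := by
  have hcard : B.1.rank.card.ord = B.1.rank := by
    refine (Cardinal.ord_card_le _).antisymm (not_lt.1 fun h => ?_)
    have := Ordinal.card_le_card_vonNeumann B.1.rank.card.ord
    rw [Cardinal.card_ord] at this
    exact this.not_gt (hB.card_vonNeumann_lt hα h)
  have hord : ∀ c : Cardinal.{0}, c < B.1.rank.card → c.ord < B.1.rank := fun c hc => by
    rwa [← hcard, Cardinal.ord_lt_ord]
  have hcle : ∀ c : Cardinal.{0}, c ≤ (ZFSet.vonNeumann c.ord).card := fun c => by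
    simpa using Ordinal.card_le_card_vonNeumann c.ord
  have hℵ : Cardinal.aleph0 < B.1.rank.card := by
    have := (hcle Cardinal.aleph0).trans_lt (hB.card_vonNeumann_lt hα (o := Cardinal.aleph0.ord)
      (by simpa using hω))
    exact this
  refine ⟨Cardinal.isInaccessible_def.2 ⟨hℵ, ⟨hℵ.le, ?_⟩, ?_, ?_⟩, hcard⟩
  · rw [hcard]
    by_contra! h
    obtain ⟨s, hs, hsc⟩ := Order.exists_cof_eq (Set.Iio B.1.rank)
    rw [Ordinal.cof_Iio, ← Ordinal.lift_cof] at hsc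
    obtain ⟨σ, hσ, H⟩ := hB.exists_bound hα (hord _ h) (s := s) (by
      rw [hsc]
      exact Cardinal.lift_le.2 (hcle _))
    obtain ⟨a, ha, hσa⟩ := hs ⟨σ, hσ⟩
    exact (H a ha).not_ge hσa
  · exact (Cardinal.aleph0_pos.trans hℵ).ne'
  · intro c hc
    have h1 := hB.card_vonNeumann_lt hα (hB.succ_lt hα (hord c hc))
    rw [Order.succ_eq_add_one, ZFSet.card_vonNeumann, Cardinal.preBeth_add_one,
      ← ZFSet.card_vonNeumann] at h1
    exact (Cardinal.power_le_power_left two_ne_zero (hcle c)).trans_lt h1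

end IsInaccLevel

/-! ### Reflecting cardinals below a pseudo uplifting cardinal -/

/-- The formula stating that there is a level `x₁₀₀₀` of inaccessible height, with `x₁` and `x₄₀`
as elements, for which the truth definition `sigma3Truth` is absolute. -/
def Fm.existsReflecting : Fm :=
  ex 1000 (and isInaccLevel (and (mem 1 1000) (and (mem 40 1000)
    (ball 6 1000 (ball 7 1000 (ball 8 1000 (ball 9 1000
      (iff (rel 1000 sigma3Truth) sigma3Truth))))))))

/-- Values of the variables with a fixed meaning in `Fm.existsReflecting`. -/
noncomputable def baseEnv (θ : Ordinal.{0}) : ℕ → ZFSet.{0}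
  | 1 => nms
  | 2 => memGraph
  | 3 => eqGraph
  | 4 => nandGraph
  | 5 => allGraph
  | 40 => ZFSet.vonNeumann θ
  | _ => nm 0

theorem rank_baseEnv_lt {θ α : Ordinal.{0}} (hω : Ordinal.omega0 < α) (hθ : θ < α) (i : ℕ) :
    (baseEnv θ i).rank < α := by
  unfold baseEnv
  split
  · rwa [rank_nms]
  · exact (rank_tripleGraph_le _ _ _).trans_lt hω
  · exact (rank_tripleGraph_le _ _ _).trans_lt hω
  · exact (rank_tripleGraph_le _ _ _).trans_lt hω
  · exact (rank_tripleGraph_le _ _ _).trans_lt hω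
  · rwa [ZFSet.rank_vonNeumann]
  · exact rank_nm_lt hω.le 0

/-- The assignment `v` with `x₆`, `x₇`, `x₈`, `x₉` replaced. -/
def setParams {M : Type 1} (v : ℕ → M) (c p q a : M) : ℕ → M :=
  Function.update (Function.update (Function.update (Function.update v 6 c) 7 p) 8 q) 9 a

theorem setParams_comp {M N : Type 1} (f : M → N) (v : ℕ → M) (c p q a : M) (i : ℕ) :
    f (setParams v c p q a i) = setParams (f ∘ v) (f c) (f p) (f q) (f a) i := by
  simp only [setParams, ← Function.comp_update]
  rfl

theorem setParams_congr {M : Type 1} {v v' : ℕ → M} {c p q a : M} {i : ℕ} (h : v i = v' i) :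
    setParams v c p q a i = setParams v' c p q a i := by
  simp only [setParams, Function.update_apply, h]

theorem sat_existsReflecting {α : Ordinal.{0}} (hα : Order.IsSuccLimit α) {v : ℕ → Vt α} :
    Sat Subtype.val existsReflecting v ↔ ∃ B : Vt α, IsInaccLevel B ∧ (v 1).1 ∈ B.1 ∧
      (v 40).1 ∈ B.1 ∧ ∀ c, c.1 ∈ B.1 → ∀ p, p.1 ∈ B.1 → ∀ q, q.1 ∈ B.1 → ∀ a, a.1 ∈ B.1 →
        (Sat Subtype.val (rel 1000 sigma3Truth) (setParams (Function.update v 1000 B) c p q a) ↔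
          Sat Subtype.val sigma3Truth (setParams (Function.update v 1000 B) c p q a)) := by
  simp only [existsReflecting, sat_ex, sat_and, sat_isInaccLevel hα, sat_ball, sat_iff, sat_mem]
  exact Iff.rfl

/-- Relativizing `sigma3Truth` to a set `B` of the form `V_β` yields `sigma3Truth` in `V_β`. -/
theorem sat_rel_sigma3Truth {α β : Ordinal.{0}} (hβα : β ≤ α) {B : Vt α}
    (hB : ∀ z, z ∈ B.1 ↔ z.rank < β) {v : ℕ → Vt α} {v' : ℕ → Vt β} (hv : v 1000 = B)
    (h : ∀ i < 1000, (v i).1 = (v' i).1) :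
    Sat Subtype.val (rel 1000 sigma3Truth) v ↔ Sat Subtype.val sigma3Truth v' :=
  sat_rel Subtype.val_injective Subtype.val_injective
    (fun z => (hB z).trans ⟨fun hz => ⟨⟨z, hz⟩, rfl⟩, fun ⟨x, hx⟩ => hx ▸ x.2⟩)
    (fun x => ⟨⟨x.1, x.2.trans_le hβα⟩, rfl⟩) _ varsLt_sigma3Truth hv h

theorem VElem.sat_existsReflecting {κ γ : Ordinal.{0}} (h : VElem κ γ) (hκ : IsInaccOrd κ)
    (hγ : IsBethLimit γ) (hκγ : κ < γ) (v : ℕ → Vt κ) :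
    Sat Subtype.val existsReflecting v := by
  rw [← h.sat_iff hκγ.le, Paper.sat_existsReflecting hγ.isSuccLimit]
  let B : Vt γ := ⟨ZFSet.vonNeumann κ, by rwa [ZFSet.rank_vonNeumann]⟩
  have hB : ∀ z, z ∈ B.1 ↔ z.rank < κ := fun z => ZFSet.mem_vonNeumann
  refine ⟨B, hκ.isInaccLevel hκγ rfl, (hB _).2 (v 1).2, (hB _).2 (v 40).2, ?_⟩
  intro c hc p hp q hq a ha
  rw [hB] at hc hp hq ha
  let w := setParams v ⟨c, hc⟩ ⟨p, hp⟩ ⟨q, hq⟩ ⟨a, ha⟩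
  have hw : ∀ i < 1000, setParams (Function.update (fun i => (⟨(v i).1,
      (v i).2.trans hκγ⟩ : Vt γ)) 1000 B) c p q a i = ⟨(w i).1, (w i).2.trans hκγ⟩ := by
    intro i hi
    refine (setParams_congr (v' := fun i => (⟨(v i).1, (v i).2.trans hκγ⟩ : Vt γ))
      (Function.update_of_ne hi.ne _ _)).trans ?_
    exact (setParams_comp (fun x : Vt κ => (⟨x.1, x.2.trans hκγ⟩ : Vt γ)) v
      ⟨c, hc⟩ ⟨p, hp⟩ ⟨q, hq⟩ ⟨a, ha⟩ i).symm
  rw [sat_rel_sigma3Truth hκγ.le hB (v' := w) rfl fun i hi => by rw [hw i hi],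
    sat_congr _ varsLt_sigma3Truth hw]
  exact (h.sat_iff hκγ.le sigma3Truth w).symm

theorem isTruthEnv_setParams {α θ : Ordinal.{0}} {v : ℕ → Vt α}
    (hv : ∀ i < 1000, (v i).1 = baseEnv θ i) {k m n : ℕ} {c p q a : Vt α} (hc : c.1 = nm k)
    (hp : p.1 = nmsLe m) (hq : q.1 = nmsLe n) : IsTruthEnv k m n (setParams v c p q a) :=
  ⟨hv 0 (by norm_num), hv 1 (by norm_num), hv 2 (by norm_num), hv 3 (by norm_num),
    hv 4 (by norm_num), hv 5 (by norm_num), hc, hp, hq⟩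

theorem realize_iff_sat_sigma3Truth {α : Ordinal.{0}} (hα : IsInaccOrd α)
    {φ : LSet.Formula (Fin 1)} {χ δ : Fm} {p q : ℕ} (hδ : δ.Absolute)
    (H1 : ∀ v : ℕ → Vt α, Sat Subtype.val (toFm φ) v ↔ ∃ w, Agree 0 w v ∧ Sat Subtype.val χ w)
    (H2 : ∀ v : ℕ → Vt α, Sat Subtype.val χ v ↔
      ∀ w, Agree p w v → ∃ u, Agree q u w ∧ Sat Subtype.val δ u)
    {v : ℕ → Vt α} (hv : IsTruthEnv δ.code p q v) :
    φ.Realize (fun _ => v 9) ↔ Sat Subtype.val sigma3Truth v := by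
  rw [realize_iff_sat (isMemStructure_Vt α), H1, sat_sigma3Truth hα hδ hv]
  refine exists_congr fun w => and_congr ?_ (H2 w)
  exact ⟨fun h => h 0 le_rfl, fun h i hi => by rw [Nat.le_zero.1 hi]; exact h⟩

theorem IsPseudoUplifting.exists_sigmaReflecting {κ : Ordinal.{0}} (h : IsPseudoUplifting κ)
    {θ : Ordinal.{0}} (hθ : θ < κ) : ∃ β, θ < β ∧ β < κ ∧ SigmaReflecting 3 β := by
  obtain ⟨γ, -, hκγ, hγ, he⟩ := h.exists_extension 0
  have hlim := h.1.isBethLimit.isSuccLimit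
  have hωκ := h.1.isBethLimit.omega_lt
  obtain ⟨B, hB, h1, h40, H⟩ := (sat_existsReflecting hlim).1 (he.sat_existsReflecting h.1 hγ hκγ
    fun i => ⟨baseEnv θ i, rank_baseEnv_lt hωκ hθ i⟩)
  have hω : Ordinal.omega0 < B.1.rank := by
    simpa [baseEnv, rank_nms] using ZFSet.rank_lt_of_mem h1
  have hθB : θ < B.1.rank := by
    simpa [baseEnv] using ZFSet.rank_lt_of_mem h40
  have hβ := hB.isInaccOrd hlim hω
  refine ⟨B.1.rank, hθB, B.2, hβ, fun φ hφ a ha => ?_⟩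
  rw [h.sigmaReflecting.2 φ hφ a (ha.trans B.2)]
  obtain ⟨χ, δ, p, q, hδ, H1, H2⟩ := hφ.normalForm
  have hnmsLe : ∀ m, (nmsLe m).rank < B.1.rank := fun m =>
    (ZFSet.rank_mono (nmsLe_subset m)).trans_lt (by rwa [rank_nms])
  let c' : Vt B.1.rank := ⟨nm δ.code, rank_nm_lt hω.le _⟩
  let p' : Vt B.1.rank := ⟨nmsLe p, hnmsLe p⟩
  let q' : Vt B.1.rank := ⟨nmsLe q, hnmsLe q⟩
  let a' : Vt B.1.rank := ⟨a, ha⟩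
  let up : Vt B.1.rank → Vt κ := fun x => ⟨x.1, x.2.trans B.2⟩
  let v' : ℕ → Vt B.1.rank := fun i => ⟨baseEnv θ i, rank_baseEnv_lt hω hθB i⟩
  let v : ℕ → Vt κ := Function.update (fun i => ⟨baseEnv θ i, rank_baseEnv_lt hωκ hθ i⟩) 1000 B
  have hv : ∀ i < 1000, v i = up (v' i) := fun i hi => Function.update_of_ne hi.ne _ _
  have hup : ∀ x, (up x).1 ∈ B.1 := fun x => (hB.mem_iff hlim).2 x.2
  have hκ := realize_iff_sat_sigma3Truth h.1 hδ (H1 _) (H2 _) (isTruthEnv_setParams (θ := θ)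
    (v := v) (c := up c') (p := up p') (q := up q') (a := up a')
    (fun i hi => by rw [hv i hi]) rfl rfl rfl)
  have hβ' := realize_iff_sat_sigma3Truth hβ hδ (H1 _) (H2 _) (isTruthEnv_setParams (θ := θ)
    (v := v') (c := c') (p := p') (q := q') (a := a') (fun _ _ => rfl) rfl rfl rfl)
  refine hκ.trans (Iff.trans ?_ hβ'.symm)
  refine (H _ (hup c') _ (hup p') _ (hup q') _ (hup a')).symm.trans ?_
  refine sat_rel_sigma3Truth B.2.le (fun z => hB.mem_iff hlim) rfl fun i hi => ?_
  exact congrArg Subtype.val ((setParams_congr (v' := up ∘ v') (hv i hi)).trans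
    (setParams_comp up v' c' p' q' a' i).symm)

/-- Every pseudo uplifting cardinal is Σ₃-reflecting and a limit of Σ₃-reflecting
cardinals. -/
theorem pseudoUplifting_sigma3_reflecting (κ : Ordinal) (h : IsPseudoUplifting κ) :
    SigmaReflecting 3 κ ∧ ∀ θ < κ, ∃ β : Ordinal, θ < β ∧ β < κ ∧ SigmaReflecting 3 β := by
  exact ⟨h.sigmaReflecting, fun θ hθ => h.exists_sigmaReflecting hθ⟩

end Paper
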